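/- arXiv:1810.05280 — 2 statements merged into one kernel-verified Lean document; each statement's English description precedes it below -/
import Mathlib

section
/- Let G be a finite simple graph with a hole cover C satisfying the NC property. If a vertex set K forms a clique in Ĝ(C) but not in G, then there exists a vertex u ∈ K ∩ C such that K \ {u} is a clique in G. -/
open SimpleGraph

variable {V : Type*}

/-- A *hole* of `G`: an induced cycle of length at least 4, given as a closed walk. -/
def IsHole (G : SimpleGraph V) {a : V} (w : G.Walk a a) : Prop :=
  w.IsCycle ∧ 4 ≤ w.length ∧
    ∀ x y : V, x ∈ w.support → y ∈ w.support → G.Adj x y → s(x, y) ∈ w.edges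

/-- A graph is *chordal* if it has no hole. -/
def IsChordal (G : SimpleGraph V) : Prop :=
  ∀ (a : V) (w : G.Walk a a), ¬ IsHole G w

/-- Two edge lists share two consecutive edges. -/
def ShareTwoConsecutiveEdges (l₁ l₂ : List (Sym2 V)) : Prop :=
  ∃ x y z : V, x ≠ z ∧ s(x, y) ∈ l₁ ∧ s(y, z) ∈ l₁ ∧ s(x, y) ∈ l₂ ∧ s(y, z) ∈ l₂

/-- A vertex `u` satisfies the *NC property* in `G`: no hole through `u` and
no hole avoiding `u` share two consecutive edges. -/
def VertexNC (G : SimpleGraph V) (u : V) : Prop :=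
  ∀ (a b : V) (w₁ : G.Walk a a) (w₂ : G.Walk b b),
    IsHole G w₁ → IsHole G w₂ → u ∈ w₁.support → u ∉ w₂.support →
      ¬ ShareTwoConsecutiveEdges w₁.edges w₂.edges

/-- A *hole cover* of `G`: a nonempty vertex set meeting every hole of `G`. -/
def IsHoleCover (G : SimpleGraph V) (C : Set V) : Prop :=
  C.Nonempty ∧ ∀ (a : V) (w : G.Walk a a), IsHole G w → ∃ u ∈ C, u ∈ w.support

/-- A vertex set `C` satisfies the *NC property* in `G`: every vertex of `C`
satisfies the NC property and every hole of `G` contains at most one vertex of `C`. -/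
def SetNC (G : SimpleGraph V) (C : Set V) : Prop :=
  (∀ u ∈ C, VertexNC G u) ∧
    ∀ (a : V) (w : G.Walk a a), IsHole G w →
      ∀ u ∈ C, ∀ v ∈ C, u ∈ w.support → v ∈ w.support → u = v

/-- A graph satisfies the *NC property* if it has a hole cover satisfying the NC property. -/
def HasNCProperty (G : SimpleGraph V) : Prop :=
  ∃ C : Set V, IsHoleCover G C ∧ SetNC G C

/-- A DP-cover of `G` with lists of size `k`, realized on the vertex set `V × Fin k`:
the fibers `{v} × Fin k` are cliques, cross edges exist only over edges of `G`,
and the edges between two fibers form a matching. -/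
def IsDPCover (G : SimpleGraph V) (k : ℕ) (H : SimpleGraph (V × Fin k)) : Prop :=
  (∀ (v : V) (i j : Fin k), i ≠ j → H.Adj (v, i) (v, j)) ∧
  (∀ (u v : V) (i j : Fin k), u ≠ v → H.Adj (u, i) (v, j) → G.Adj u v) ∧
  (∀ (u v : V) (i j j' : Fin k), u ≠ v → H.Adj (u, i) (v, j) → H.Adj (u, i) (v, j') → j = j')

/-- `G` is DP-`k`-colorable: every DP-cover with lists of size `k` admits an
independent transversal. -/
def DPColorable (G : SimpleGraph V) (k : ℕ) : Prop :=
  ∀ H : SimpleGraph (V × Fin k), IsDPCover G k H →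
    ∃ f : V → Fin k, ∀ u v : V, ¬ H.Adj (u, f u) (v, f v)

/-- The DP-chromatic number: the least `k` such that `G` is DP-`k`-colorable. -/
noncomputable def dpChromaticNumber (G : SimpleGraph V) : ℕ :=
  sInf {k | DPColorable G k}

/-- `M` is a minor of `G`, via the branch-set characterization. -/
def HasMinor {W : Type*} (G : SimpleGraph V) (M : SimpleGraph W) : Prop :=
  ∃ B : W → Set V,
    (∀ i, (B i).Nonempty) ∧
    (∀ i, (G.induce (B i)).Connected) ∧
    (Pairwise fun i j => Disjoint (B i) (B j)) ∧
    ∀ i j, M.Adj i j → ∃ a ∈ B i, ∃ b ∈ B j, G.Adj a b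

/-- Locally chordalize by `u` all holes of `G` containing `u`: add all edges
joining `u` to the vertices of such holes (new edges go to the vertices
nonadjacent to `u`). -/
def localChordalize (G : SimpleGraph V) (u : V) : SimpleGraph V :=
  G ⊔ SimpleGraph.fromRel fun x y =>
    x = u ∧ ∃ (a : V) (w : G.Walk a a), IsHole G w ∧ u ∈ w.support ∧ y ∈ w.support

/-- Recursive local chordalizations along a list of vertices. -/
def chordalizeList (G : SimpleGraph V) : List V → SimpleGraph V
  | [] => G
  | u :: l => chordalizeList (localChordalize G u) l

/-- Delete a vertex set (keeping the ambient vertex type: the removed vertices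
become isolated). -/
def removeVerts (G : SimpleGraph V) (A : Set V) : SimpleGraph V where
  Adj x y := G.Adj x y ∧ x ∉ A ∧ y ∉ A
  symm := by constructor; intro x y h; exact ⟨h.1.symm, h.2.2, h.2.1⟩
  loopless := by constructor; intro x h; exact G.loopless.irrefl x h.1

/-- The chordalization chain corresponding to an ordered partition
`parts 0, …, parts (k-1)` (playing the role of `C₁, …, C_k`) of a hole cover:
`(lcChain G parts i).1 = Gᵢ` and `(lcChain G parts i).2 = Gᵢ*`. -/
def lcChain (G : SimpleGraph V) {k : ℕ} (parts : Fin k → List V) :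
    ℕ → SimpleGraph V × SimpleGraph V
  | 0 =>
      (removeVerts G {v | ∃ i, v ∈ parts i}, removeVerts G {v | ∃ i, v ∈ parts i})
  | i + 1 =>
      let Gi := (lcChain G parts i).2 ⊔
        removeVerts G {v | ∃ j : Fin k, i + 1 ≤ (j : ℕ) ∧ v ∈ parts j}
      (Gi, if h : i < k then chordalizeList Gi (parts ⟨i, h⟩) else Gi)

/-- `(parts 0, …, parts (k-1))` is a *local chordalization partition* of the hole
cover `C` of `G`. -/
def IsLCPartition (G : SimpleGraph V) (C : Set V) {k : ℕ} (parts : Fin k → List V) : Prop :=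
  (∀ i, (parts i).Nodup) ∧
  (∀ i, parts i ≠ []) ∧
  (Pairwise fun i j : Fin k => ∀ v, v ∈ parts i → v ∉ parts j) ∧
  {v | ∃ i, v ∈ parts i} = C ∧
  ∀ i : Fin k,
    IsHoleCover (lcChain G parts ((i : ℕ) + 1)).1 {v | v ∈ parts i} ∧
    SetNC (lcChain G parts ((i : ℕ) + 1)).1 {v | v ∈ parts i} ∧
    IsChordal (lcChain G parts ((i : ℕ) + 1)).2

/-- The *non-chordality index* of `G`. -/
noncomputable def ncIndex (G : SimpleGraph V) : ℕ := by
  classical exact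
    if IsChordal G then 0
    else sInf {k | ∃ (C : Set V) (parts : Fin k → List V),
      IsHoleCover G C ∧ IsLCPartition G C parts}

/-- `G` is `k`-list-colorable. -/
def ListColorable (G : SimpleGraph V) (k : ℕ) : Prop :=
  ∀ L : V → Finset ℕ, (∀ v, k ≤ (L v).card) →
    ∃ f : V → ℕ, (∀ v, f v ∈ L v) ∧ ∀ u v : V, G.Adj u v → f u ≠ f v

/-- The list chromatic number of `G`. -/
noncomputable def listChromaticNumber (G : SimpleGraph V) : ℕ :=
  sInf {k | ListColorable G k}

/-- `a` and `b` are joined by a walk inside `T`. -/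
def ConnIn (G : SimpleGraph V) (T : Set V) (a b : V) : Prop :=
  ∃ p : G.Walk a b, ∀ v ∈ p.support, v ∈ T

/-- Two sets meet or are joined by an edge. -/
def Touch (G : SimpleGraph V) (A B : Set V) : Prop :=
  ∃ a ∈ A, ∃ b ∈ B, a = b ∨ G.Adj a b

/-- `u` and `v` lie on a common hole. -/
def OnHole (G : SimpleGraph V) (u v : V) : Prop :=
  ∃ (a : V) (w : G.Walk a a), IsHole G w ∧ u ∈ w.support ∧ v ∈ w.support

theorem ConnIn.refl {G : SimpleGraph V} {T : Set V} {a : V} (h : a ∈ T) : ConnIn G T a a :=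
  ⟨Walk.nil, by simpa using h⟩

theorem ConnIn.trans {G : SimpleGraph V} {T : Set V} {a b c : V}
    (h : ConnIn G T a b) (h' : ConnIn G T b c) : ConnIn G T a c := by
  obtain ⟨p, hp⟩ := h
  obtain ⟨q, hq⟩ := h'
  refine ⟨p.append q, fun v hv => ?_⟩
  rcases (Walk.mem_support_append_iff p q).1 hv with h | h
  · exact hp v h
  · exact hq v h

theorem ConnIn.symm {G : SimpleGraph V} {T : Set V} {a b : V}
    (h : ConnIn G T a b) : ConnIn G T b a := by
  obtain ⟨p, hp⟩ := h
  exact ⟨p.reverse, fun v hv => hp v (by simpa using hv)⟩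

theorem ConnIn.mono {G : SimpleGraph V} {T T' : Set V} {a b : V}
    (h : ConnIn G T a b) (hT : T ⊆ T') : ConnIn G T' a b := by
  obtain ⟨p, hp⟩ := h
  exact ⟨p, fun v hv => hT (hp v hv)⟩

theorem ConnIn.edge {G : SimpleGraph V} {T : Set V} {a b : V}
    (ha : a ∈ T) (hb : b ∈ T) (h : a = b ∨ G.Adj a b) : ConnIn G T a b := by
  rcases h with rfl | h
  · exact ConnIn.refl ha
  · refine ⟨Walk.cons h Walk.nil, fun v hv => ?_⟩
    simp at hv
    rcases hv with rfl | rfl <;> assumption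

/-- `T` is connected. -/
def CSet (G : SimpleGraph V) (T : Set V) : Prop := ∀ a ∈ T, ∀ b ∈ T, ConnIn G T a b

theorem CSet.singleton {G : SimpleGraph V} (x : V) : CSet G {x} := by
  rintro a rfl b rfl
  exact ConnIn.refl rfl

theorem CSet.union {G : SimpleGraph V} {A B : Set V} (hA : CSet G A) (hB : CSet G B)
    (h : Touch G A B) : CSet G (A ∪ B) := by
  obtain ⟨a, ha, b, hb, hab⟩ := h
  have key : ∀ x ∈ A, ∀ y ∈ B, ConnIn G (A ∪ B) x y := fun x hx y hy =>
    ((hA x hx a ha).mono Set.subset_union_left).trans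
      ((ConnIn.edge (T := A ∪ B) (Or.inl ha) (Or.inr hb) hab).trans
        ((hB b hb y hy).mono Set.subset_union_right))
  rintro x (hx | hx) y (hy | hy)
  · exact (hA x hx y hy).mono Set.subset_union_left
  · exact key x hx y hy
  · exact (key y hy x hx).symm
  · exact (hB x hx y hy).mono Set.subset_union_right

theorem Touch.symm {G : SimpleGraph V} {A B : Set V} (h : Touch G A B) : Touch G B A := by
  obtain ⟨a, ha, b, hb, hab⟩ := h
  exact ⟨b, hb, a, ha, hab.imp Eq.symm fun h => h.symm⟩

theorem Touch.mono {G : SimpleGraph V} {A B A' B' : Set V} (h : Touch G A B)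
    (hA : A ⊆ A') (hB : B ⊆ B') : Touch G A' B' := by
  obtain ⟨a, ha, b, hb, hab⟩ := h
  exact ⟨a, hA ha, b, hB hb, hab⟩

/-- A walk inside `X ∪ D ∪ Y` from `X` to `Y` meets `D` if `X`, `Y` do not touch. -/
theorem walk_meets {G : SimpleGraph V} {X Y D : Set V} (hXY : ¬ Touch G X Y) {a b : V}
    (p : G.Walk a b) (ha : a ∈ X) (hb : b ∈ Y) (hp : ∀ v ∈ p.support, v ∈ X ∪ D ∪ Y) :
    ∃ d ∈ p.support, d ∈ D := by
  induction p with
  | nil => exact absurd ⟨_, ha, _, hb, Or.inl rfl⟩ hXY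
  | @cons a c b h p ih =>
    have hc : c ∈ X ∪ D ∪ Y := hp c (by simp)
    rcases hc with (hc | hc) | hc
    · obtain ⟨d, hd, hd'⟩ := ih hc hb (fun v hv => hp v (by simp [hv]))
      exact ⟨d, by simp [hd], hd'⟩
    · exact ⟨c, by simp, hc⟩
    · exact absurd ⟨_, ha, _, hc, Or.inr h⟩ hXY

/-- Shortest walks inside a set are chordless paths. -/
theorem exists_chordless {G : SimpleGraph V} {T : Set V} {a b : V} (h : ConnIn G T a b) :
    ∃ p : G.Walk a b, (∀ v ∈ p.support, v ∈ T) ∧ p.IsPath ∧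
      ∀ x y : V, x ∈ p.support → y ∈ p.support → G.Adj x y → s(x, y) ∈ p.edges := by
  classical
  have hex : ∃ n, ∃ p : G.Walk a b, (∀ v ∈ p.support, v ∈ T) ∧ p.length = n := by
    obtain ⟨p, hp⟩ := h
    exact ⟨_, p, hp, rfl⟩
  obtain ⟨p0, hp0, hl0⟩ := Nat.find_spec hex
  have hmin : ∀ q : G.Walk a b, (∀ v ∈ q.support, v ∈ T) → p0.length ≤ q.length := by
    intro q hq
    rw [hl0]
    exact Nat.find_min' hex ⟨q, hq, rfl⟩
  set p := p0.bypass with hpdef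
  have hpT : ∀ v ∈ p.support, v ∈ T := fun v hv => hp0 v (p0.support_bypass_subset_support hv)
  have hmin' : ∀ q : G.Walk a b, (∀ v ∈ q.support, v ∈ T) → p.length ≤ q.length :=
    fun q hq => (p0.length_bypass_le_length).trans (hmin q hq)
  have key : ∀ i j, i < j → j ≤ p.length → G.Adj (p.getVert i) (p.getVert j) →
      s(p.getVert i, p.getVert j) ∈ p.edges := by
    intro i j hij hj hadj
    have hlen := hmin' ((p.take i).append (Walk.cons hadj (p.drop j))) (by
      intro v hv
      rcases (Walk.mem_support_append_iff _ _).1 hv with h | h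
      · exact hpT v ((p.isSubwalk_take i).support_subset h)
      · rw [Walk.support_cons, List.mem_cons] at h
        rcases h with rfl | h
        · exact hpT _ (p.getVert_mem_support i)
        · exact hpT v ((p.isSubwalk_drop j).support_subset h))
    rw [Walk.length_append, Walk.length_cons, Walk.take_length, Walk.drop_length] at hlen
    have : j = i + 1 := by omega
    subst this
    exact (Walk.mk_mem_edges_iff_exists p).2 ⟨i, by omega, rfl⟩
  refine ⟨p, hpT, p0.bypass_isPath, fun x y hx hy hadj => ?_⟩
  obtain ⟨i, rfl, hi⟩ := Walk.mem_support_iff_exists_getVert.1 hx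
  obtain ⟨j, rfl, hj⟩ := Walk.mem_support_iff_exists_getVert.1 hy
  rcases lt_trichotomy i j with h | h | h
  · exact key i j h hj hadj
  · subst h
    exact absurd rfl hadj.ne
  · rw [Sym2.eq_swap]
    exact key j i h hi hadj.symm

/-- Closing lemma. -/
theorem exists_hole {G : SimpleGraph V} {T : Set V} {c n m : V} (hn : G.Adj c n) (hm : G.Adj c m)
    (hne : n ≠ m) (hnm : ¬ G.Adj n m) (hT : ConnIn G T n m) (hc : c ∉ T)
    (hTc : ∀ v ∈ T, G.Adj c v → v = n ∨ v = m) :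
    ∃ p : G.Walk n m, (∀ v ∈ p.support, v ∈ T) ∧ ∃ w : G.Walk c c, IsHole G w ∧
      ∀ v, v ∈ w.support ↔ v = c ∨ v ∈ p.support := by
  obtain ⟨p, hpT, hpath, hch⟩ := exists_chordless hT
  refine ⟨p, hpT, Walk.cons hn (p.concat hm.symm), ⟨?_, ?_, ?_⟩, ?_⟩
  · rw [Walk.cons_isCycle_iff, Walk.concat_isPath_iff]
    refine ⟨⟨hpath, fun h => hc (hpT _ h)⟩, ?_⟩
    rw [Walk.edges_concat]
    intro h
    simp only [List.concat_eq_append, List.mem_append, List.mem_singleton] at h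
    rcases h with h | h
    · exact hc (hpT _ (p.fst_mem_support_of_mem_edges h))
    · rcases Sym2.eq_iff.1 h with ⟨h1, h2⟩ | ⟨h1, h2⟩
      · exact hm.ne h1
      · exact hne h2
  · rw [Walk.length_cons, Walk.length_concat]
    rcases hl : p.length with _ | _ | k
    · exact absurd (Walk.eq_of_length_eq_zero hl) hne
    · exact absurd (Walk.adj_of_length_eq_one hl) hnm
    · omega
  · have hcadj : ∀ y, y ∈ p.support → G.Adj c y →
        s(c, y) ∈ (Walk.cons hn (p.concat hm.symm)).edges := by
      intro y hy hadj
      rw [Walk.edges_cons, Walk.edges_concat]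
      rcases hTc y (hpT y hy) hadj with rfl | rfl
      · simp
      · simp [Sym2.eq_swap]
    intro x y hx hy hadj
    simp only [Walk.support_cons, Walk.support_concat, List.concat_eq_append, List.mem_cons,
      List.mem_append, List.not_mem_nil, or_false] at hx hy
    have hx' : x = c ∨ x ∈ p.support := by tauto
    have hy' : y = c ∨ y ∈ p.support := by tauto
    rcases hx' with rfl | hx' <;> rcases hy' with rfl | hy'
    · exact absurd rfl hadj.ne
    · exact hcadj y hy' hadj
    · rw [Sym2.eq_swap]
      exact hcadj x hx' hadj.symm
    · rw [Walk.edges_cons, Walk.edges_concat]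
      have := hch x y hx' hy' hadj
      simp [this]
  · intro v
    simp only [Walk.support_cons, Walk.support_concat, List.concat_eq_append, List.mem_cons,
      List.mem_append, List.not_mem_nil, or_false]
    tauto

/-- Index description of a hole. -/
theorem hole_fun {G : SimpleGraph V} {a u : V} {w : G.Walk a a} (hw : IsHole G w)
    (hu : u ∈ w.support) :
    ∃ (n : ℕ) (h : ℕ → V), 4 ≤ n ∧ h 0 = u ∧ (∀ v, v ∈ w.support ↔ ∃ i, i < n ∧ h i = v) ∧
      (∀ i j, i < n → j < n → h i = h j → i = j) ∧
      ∀ i j, i < n → j < n → (G.Adj (h i) (h j) ↔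
        (i + 1 = j ∨ j + 1 = i ∨ (i = 0 ∧ j + 1 = n) ∨ (j = 0 ∧ i + 1 = n))) := by
  classical
  obtain ⟨hcyc, hlen, hch⟩ := hw
  set w' := w.rotate u hu with hw'
  have hcyc' : w'.IsCycle := hcyc.rotate hu
  have hlen' : w'.length = w.length := w.length_rotate u hu
  have hsup : ∀ v, v ∈ w.support ↔ v ∈ w'.support := fun v =>
    (Walk.mem_support_rotate_iff w u hu).symm
  have hinj := hcyc'.getVert_injOn'
  have h0 : w'.getVert 0 = u := w'.getVert_zero
  have hN : w'.getVert w'.length = u := w'.getVert_length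
  have hinj' : ∀ i j, i < w'.length → j < w'.length → w'.getVert i = w'.getVert j → i = j := by
    intro i j hi hj h
    exact hinj (by simp; omega) (by simp; omega) h
  refine ⟨w'.length, w'.getVert, by omega, h0, fun v => ?_, hinj', ?_⟩
  · rw [hsup, Walk.mem_support_iff_exists_getVert]
    constructor
    · rintro ⟨i, rfl, hi⟩
      rcases hi.lt_or_eq with h | h
      · exact ⟨i, h, rfl⟩
      · exact ⟨0, by omega, by rw [h, h0, hN]⟩
    · rintro ⟨i, hi, rfl⟩
      exact ⟨i, rfl, hi.le⟩
  · intro i j hi hj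
    constructor
    · intro hadj
      have hmem := hch _ _ ((hsup _).2 (w'.getVert_mem_support i))
        ((hsup _).2 (w'.getVert_mem_support j)) hadj
      have hmem' : s(w'.getVert i, w'.getVert j) ∈ w'.edges :=
        (w.rotate_edges u hu).perm.mem_iff.2 hmem
      obtain ⟨k, hk, hkk⟩ := (Walk.mk_mem_edges_iff_exists w').1 hmem'
      have hsucc : ∀ m, m < w'.length → w'.getVert (k + 1) = w'.getVert m →
          k + 1 = m ∨ (k + 1 = w'.length ∧ m = 0) := by
        intro m hm h
        rcases Nat.lt_or_ge (k + 1) w'.length with h' | h'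
        · exact Or.inl (hinj' _ _ h' hm h)
        · have : k + 1 = w'.length := by omega
          refine Or.inr ⟨this, ?_⟩
          rw [this, hN] at h
          replace h := h0.trans h
          exact (hinj' _ _ (by omega) hm h).symm
      rcases Sym2.eq_iff.1 hkk with ⟨h1, h2⟩ | ⟨h1, h2⟩
      · have := hinj' _ _ hk hi h1
        have := hsucc j hj h2
        omega
      · have := hinj' _ _ hk hj h1
        have := hsucc i hi h2
        omega
    · have hs : ∀ i j, i < w'.length → j < w'.length → i + 1 = j →
          G.Adj (w'.getVert i) (w'.getVert j) := by
        rintro i j hi hj rfl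
        exact w'.adj_getVert_succ hi
      have hl : ∀ i j, i < w'.length → i = 0 ∧ j + 1 = w'.length →
          G.Adj (w'.getVert i) (w'.getVert j) := by
        rintro i j hi ⟨rfl, hj⟩
        have := w'.adj_getVert_succ (i := j) (by omega)
        rw [hj, hN] at this
        rw [h0]
        exact this.symm
      rintro (h | h | h | h)
      · exact hs i j hi hj h
      · exact (hs j i hj hi h).symm
      · exact hl i j hi h
      · exact (hl j i hj h).symm

/-- An open arm of a hole between `u` and `x`. -/
structure Arm (G : SimpleGraph V) (u x : V) (L : Set V) (m n : V) : Prop where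
  mL : m ∈ L
  nL : n ∈ L
  um : G.Adj u m
  xn : G.Adj x n
  u_only : ∀ v ∈ L, G.Adj u v → v = m
  x_only : ∀ v ∈ L, G.Adj x v → v = n
  conn : CSet G L
  uL : u ∉ L
  xL : x ∉ L

theorem interval_conn {G : SimpleGraph V} (h : ℕ → V) (a b : ℕ)
    (hadj : ∀ i, a ≤ i → i < b → G.Adj (h i) (h (i + 1))) :
    CSet G {v | ∃ i, a ≤ i ∧ i ≤ b ∧ h i = v} := by
  have key : ∀ d i, a ≤ i → i + d ≤ b →
      ConnIn G {v | ∃ i, a ≤ i ∧ i ≤ b ∧ h i = v} (h i) (h (i + d)) := by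
    intro d
    induction d with
    | zero => exact fun i hi hb => ConnIn.refl ⟨i, hi, hb, rfl⟩
    | succ d ih =>
      intro i hi hb
      refine (ih i hi (by omega)).trans (ConnIn.edge ⟨i + d, by omega, by omega, rfl⟩
        ⟨i + (d + 1), by omega, by omega, rfl⟩ (Or.inr ?_))
      exact hadj (i + d) (by omega) (by omega)
  rintro _ ⟨i, hi, hi', rfl⟩ _ ⟨j, hj, hj', rfl⟩
  rcases Nat.le_total i j with hij | hij
  · have := key (j - i) i hi (by omega)
    rwa [show i + (j - i) = j by omega] at this
  · have := key (i - j) j hj (by omega)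
    rw [show j + (i - j) = i by omega] at this
    exact this.symm

theorem exists_arms {G : SimpleGraph V} {a u x : V} {w : G.Walk a a} (hw : IsHole G w)
    (hu : u ∈ w.support) (hx : x ∈ w.support) (hne : x ≠ u) (hna : ¬ G.Adj u x) :
    ∃ L₁ m₁ n₁ L₂ m₂ n₂, Arm G u x L₁ m₁ n₁ ∧ Arm G u x L₂ m₂ n₂ ∧ ¬ Touch G L₁ L₂ ∧
      (∀ v ∈ L₁, v ∈ w.support) ∧ (∀ v ∈ L₂, v ∈ w.support) := by
  obtain ⟨n, h, hn, h0, hsup, hinj, hadj⟩ := hole_fun hw hu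
  obtain ⟨k, hk, rfl⟩ := (hsup x).1 hx
  subst h0
  have hk0 : k ≠ 0 := by rintro rfl; exact hne rfl
  rw [hadj 0 k (by omega) hk] at hna
  refine ⟨{v | ∃ i, 1 ≤ i ∧ i ≤ k - 1 ∧ h i = v}, h 1, h (k - 1),
    {v | ∃ i, k + 1 ≤ i ∧ i ≤ n - 1 ∧ h i = v}, h (n - 1), h (k + 1), ?_, ?_, ?_, ?_, ?_⟩
  · constructor
    · exact ⟨1, by omega, by omega, rfl⟩
    · exact ⟨k - 1, by omega, by omega, rfl⟩
    · rw [hadj _ _ (by omega) (by omega)]; omega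
    · rw [hadj _ _ (by omega) (by omega)]; omega
    · rintro _ ⟨i, hi, hi', rfl⟩ h1
      rw [hadj _ _ (by omega) (by omega)] at h1
      congr 1; omega
    · rintro _ ⟨i, hi, hi', rfl⟩ h1
      rw [hadj _ _ (by omega) (by omega)] at h1
      congr 1; omega
    · apply interval_conn
      intro i hi hi'
      rw [hadj _ _ (by omega) (by omega)]; omega
    · rintro ⟨i, hi, hi', h1⟩
      have := hinj _ _ (by omega) (by omega) h1
      omega
    · rintro ⟨i, hi, hi', h1⟩
      have := hinj _ _ (by omega) (by omega) h1
      omega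
  · constructor
    · exact ⟨n - 1, by omega, by omega, rfl⟩
    · exact ⟨k + 1, by omega, by omega, rfl⟩
    · rw [hadj _ _ (by omega) (by omega)]; omega
    · rw [hadj _ _ (by omega) (by omega)]; omega
    · rintro _ ⟨i, hi, hi', rfl⟩ h1
      rw [hadj _ _ (by omega) (by omega)] at h1
      congr 1; omega
    · rintro _ ⟨i, hi, hi', rfl⟩ h1
      rw [hadj _ _ (by omega) (by omega)] at h1
      congr 1; omega
    · apply interval_conn
      intro i hi hi'
      rw [hadj _ _ (by omega) (by omega)]; omega
    · rintro ⟨i, hi, hi', h1⟩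
      have := hinj _ _ (by omega) (by omega) h1
      omega
    · rintro ⟨i, hi, hi', h1⟩
      have := hinj _ _ (by omega) (by omega) h1
      omega
  · rintro ⟨_, ⟨i, hi, hi', rfl⟩, _, ⟨j, hj, hj', rfl⟩, h1 | h1⟩
    · have := hinj _ _ (by omega) (by omega) h1
      omega
    · rw [hadj _ _ (by omega) (by omega)] at h1
      omega
  · rintro _ ⟨i, hi, hi', rfl⟩
    exact (hsup _).2 ⟨i, by omega, rfl⟩
  · rintro _ ⟨i, hi, hi', rfl⟩
    exact (hsup _).2 ⟨i, by omega, rfl⟩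

/-- The arms of a `u`-hole at `x` cannot both touch a connected set missing `u` and `N[x]`. -/
theorem not_touch_both {G : SimpleGraph V} {u : V} (hNC : VertexNC G u) {a x : V}
    {w : G.Walk a a} (hw : IsHole G w) (hu : u ∈ w.support) (hx : x ∈ w.support)
    (hxu : x ≠ u)
    {L₁ L₂ : Set V} {m₁ n₁ m₂ n₂ : V} (A₁ : Arm G u x L₁ m₁ n₁) (A₂ : Arm G u x L₂ m₂ n₂)
    (hL : ¬ Touch G L₁ L₂) (hw₁ : ∀ v ∈ L₁, v ∈ w.support) (hw₂ : ∀ v ∈ L₂, v ∈ w.support)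
    {Z : Set V} (hZ : CSet G Z) (hZu : u ∉ Z) (hZx : x ∉ Z) (hZa : ∀ v ∈ Z, ¬ G.Adj x v)
    (h₁ : Touch G L₁ Z) (h₂ : Touch G L₂ Z) : False := by
  have hne : n₁ ≠ n₂ := fun h => hL ⟨n₁, A₁.nL, n₂, A₂.nL, Or.inl h⟩
  have hna : ¬ G.Adj n₁ n₂ := fun h => hL ⟨n₁, A₁.nL, n₂, A₂.nL, Or.inr h⟩
  have hcs : CSet G (L₁ ∪ Z ∪ L₂) :=
    (A₁.conn.union hZ h₁).union A₂.conn (h₂.symm.mono Set.subset_union_right subset_rfl)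
  obtain ⟨p, hp, w', hw', hs⟩ := exists_hole A₁.xn A₂.xn hne hna
    (hcs n₁ (Or.inl (Or.inl A₁.nL)) n₂ (Or.inr A₂.nL))
    (by rintro ((h | h) | h); exacts [A₁.xL h, hZx h, A₂.xL h])
    (by
      rintro v ((h | h) | h) hv
      · exact Or.inl (A₁.x_only v h hv)
      · exact absurd hv (hZa v h)
      · exact Or.inr (A₂.x_only v h hv))
  have hu' : u ∉ w'.support := by
    rw [hs]
    rintro (h | h)
    · exact hxu h.symm
    · rcases hp _ h with (h | h) | h
      exacts [A₁.uL h, hZu h, A₂.uL h]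
  have hx' : x ∈ w'.support := (hs _).2 (Or.inl rfl)
  have hn1 : n₁ ∈ w'.support := (hs _).2 (Or.inr p.start_mem_support)
  have hn2 : n₂ ∈ w'.support := (hs _).2 (Or.inr p.end_mem_support)
  exact hNC _ _ w w' hw hw' hu hu' ⟨n₁, x, n₂, hne,
    hw.2.2 _ _ (hw₁ _ A₁.nL) hx A₁.xn.symm, hw.2.2 _ _ hx (hw₂ _ A₂.nL) A₂.xn,
    hw'.2.2 _ _ hn1 hx' A₁.xn.symm, hw'.2.2 _ _ hx' hn2 A₂.xn⟩

theorem must_touch {G : SimpleGraph V} {u : V} {X Y D : Set V} {m m' : V}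
    (hX : CSet G X) (hY : CSet G Y) (hD : CSet G D)
    (hmX : m ∈ X) (hmY : m' ∈ Y) (hum : G.Adj u m) (hum' : G.Adj u m')
    (hXo : ∀ v ∈ X, G.Adj u v → v = m) (hYo : ∀ v ∈ Y, G.Adj u v → v = m')
    (huX : u ∉ X) (huY : u ∉ Y) (huD : u ∉ D) (hDu : ∀ v ∈ D, ¬ G.Adj u v)
    (hDH : ∀ v ∈ D, ¬ OnHole G u v) (hXD : Touch G X D) (hYD : Touch G Y D) : Touch G X Y := by
  by_contra hXY
  have hcs : CSet G (X ∪ D ∪ Y) :=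
    (hX.union hD hXD).union hY (hYD.symm.mono Set.subset_union_right subset_rfl)
  obtain ⟨p, hp, w, hw, hs⟩ := exists_hole hum hum'
    (fun h => hXY ⟨m, hmX, m', hmY, Or.inl h⟩) (fun h => hXY ⟨m, hmX, m', hmY, Or.inr h⟩)
    (hcs m (Or.inl (Or.inl hmX)) m' (Or.inr hmY))
    (by rintro ((h | h) | h); exacts [huX h, huD h, huY h])
    (by
      rintro v ((h | h) | h) hv
      · exact Or.inl (hXo v h hv)
      · exact absurd hv (hDu v h)
      · exact Or.inr (hYo v h hv))
  obtain ⟨d, hd, hdD⟩ := walk_meets hXY p hmX hmY hp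
  exact hDH d hdD ⟨u, w, hw, (hs _).2 (Or.inl rfl), (hs _).2 (Or.inr hd)⟩

/-- Arm together with its end `x`. -/
theorem Arm.closed {G : SimpleGraph V} {u x : V} {L : Set V} {m n : V} (A : Arm G u x L m n)
    (hna : ¬ G.Adj u x) (hne : x ≠ u) :
    CSet G (L ∪ {x}) ∧ m ∈ L ∪ {x} ∧ (∀ v ∈ L ∪ {x}, G.Adj u v → v = m) ∧ u ∉ L ∪ {x} := by
  refine ⟨A.conn.union (CSet.singleton x) ⟨n, A.nL, x, rfl, Or.inr A.xn.symm⟩, Or.inl A.mL, ?_, ?_⟩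
  · rintro v (h | h) hv
    · exact A.u_only v h hv
    · rw [Set.mem_singleton_iff] at h
      subst h
      exact absurd hv hna
  · rintro (h | h)
    · exact A.uL h
    · exact hne h.symm

theorem Touch.of_union_singleton {G : SimpleGraph V} {L B : Set V} {x : V}
    (h : Touch G (L ∪ {x}) B) (hx : ¬ Touch G {x} B) : Touch G L B := by
  obtain ⟨a, ha | ha, b, hb, hab⟩ := h
  · exact ⟨a, ha, b, hb, hab⟩
  · exact absurd ⟨a, ha, b, hb, hab⟩ hx

theorem not_touch_singleton {G : SimpleGraph V} {x y : V} (hne : x ≠ y) (hna : ¬ G.Adj x y) :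
    ¬ Touch G {x} {y} := by
  rintro ⟨a, rfl, b, rfl, h | h⟩
  · exact hne h
  · exact hna h

/-- Core configuration: one end on a hole, the other adjacent to `u`. -/
theorem core_mixed {G : SimpleGraph V} {u : V} (hNC : VertexNC G u) {D : Set V}
    (hD : CSet G D) (huD : u ∉ D) (hDu : ∀ v ∈ D, ¬ G.Adj u v) (hDH : ∀ v ∈ D, ¬ OnHole G u v)
    {x y : V} (hxu : x ≠ u) (hyu : y ≠ u) (hxy : x ≠ y) (hna : ¬ G.Adj x y)
    (hxD : Touch G {x} D) (hyD : Touch G {y} D) (hx : OnHole G u x) (hux : ¬ G.Adj u x)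
    (hy : G.Adj u y) : False := by
  obtain ⟨a, w, hw, huw, hxw⟩ := hx
  obtain ⟨L₁, m₁, n₁, L₂, m₂, n₂, A₁, A₂, hL, hw₁, hw₂⟩ := exists_arms hw huw hxw hxu hux
  have step : ∀ L m n, Arm G u x L m n → Touch G L {y} := by
    intro L m n A
    obtain ⟨c1, c2, c3, c4⟩ := A.closed hux hxu
    refine Touch.of_union_singleton (must_touch c1 (CSet.singleton y) hD c2 rfl A.um hy c3
      (fun v hv _ => hv) c4 (fun h => hyu h.symm) huD hDu hDH
      (hxD.mono Set.subset_union_right subset_rfl) hyD) (not_touch_singleton hxy hna)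
  refine not_touch_both hNC hw huw hxw hxu A₁ A₂ hL hw₁ hw₂ (CSet.singleton y)
    (fun h => hyu h.symm) hxy ?_ (step _ _ _ A₁) (step _ _ _ A₂)
  rintro v rfl
  exact hna

theorem core {G : SimpleGraph V} {u : V} (hNC : VertexNC G u) {D : Set V}
    (hD : CSet G D) (huD : u ∉ D) (hDu : ∀ v ∈ D, ¬ G.Adj u v) (hDH : ∀ v ∈ D, ¬ OnHole G u v)
    {x y : V} (hxu : x ≠ u) (hyu : y ≠ u) (hxy : x ≠ y) (hna : ¬ G.Adj x y)
    (hxD : Touch G {x} D) (hyD : Touch G {y} D) (hx : G.Adj u x ∨ OnHole G u x)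
    (hy : G.Adj u y ∨ OnHole G u y) : False := by
  by_cases hux : G.Adj u x
  · by_cases huy : G.Adj u y
    · exact not_touch_singleton hxy hna (must_touch (CSet.singleton x) (CSet.singleton y) hD rfl rfl
        hux huy (fun v hv _ => hv) (fun v hv _ => hv) (fun h => hxu h.symm) (fun h => hyu h.symm)
        huD hDu hDH hxD hyD)
    · exact core_mixed hNC hD huD hDu hDH hyu hxu hxy.symm (fun h => hna h.symm) hyD hxD
        (hy.resolve_left huy) huy hux
  · by_cases huy : G.Adj u y
    · exact core_mixed hNC hD huD hDu hDH hxu hyu hxy hna hxD hyD (hx.resolve_left hux) hux huy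
    · obtain ⟨a, w, hw, huw, hxw⟩ := hx.resolve_left hux
      obtain ⟨b, w', hw', huw', hyw'⟩ := hy.resolve_left huy
      obtain ⟨L₁, m₁, n₁, L₂, m₂, n₂, A₁, A₂, hL, hw₁, hw₂⟩ := exists_arms hw huw hxw hxu hux
      obtain ⟨R₁, k₁, l₁, R₂, k₂, l₂, B₁, B₂, hR, hw₁', hw₂'⟩ := exists_arms hw' huw' hyw' hyu huy
      have touch : ∀ L m n R k l, Arm G u x L m n → Arm G u y R k l →
          Touch G (L ∪ {x}) (R ∪ {y}) := by
        intro L m n R k l A B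
        obtain ⟨c1, c2, c3, c4⟩ := A.closed hux hxu
        obtain ⟨d1, d2, d3, d4⟩ := B.closed huy hyu
        exact must_touch c1 d1 hD c2 d2 A.um B.um c3 d3 c4 d4 huD hDu hDH
          (hxD.mono Set.subset_union_right subset_rfl) (hyD.mono Set.subset_union_right subset_rfl)
      have step : ∀ R k l, Arm G u y R k l → Touch G R {x} := by
        intro R k l B
        obtain ⟨d1, d2, d3, d4⟩ := B.closed huy hyu
        have : Touch G {x} (R ∪ {y}) := by
          by_contra hcon
          refine not_touch_both hNC hw huw hxw hxu A₁ A₂ hL hw₁ hw₂ d1 d4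
            (fun h => hcon ⟨x, rfl, x, h, Or.inl rfl⟩)
            (fun v hv h => hcon ⟨x, rfl, v, hv, Or.inr h⟩)
            ((touch _ _ _ _ _ _ A₁ B).of_union_singleton hcon)
            ((touch _ _ _ _ _ _ A₂ B).of_union_singleton hcon)
        exact this.symm.of_union_singleton
          (not_touch_singleton hxy.symm (fun h => hna h.symm))
      refine not_touch_both hNC hw' huw' hyw' hyu B₁ B₂ hR hw₁' hw₂' (CSet.singleton x)
        (fun h => hxu h.symm) hxy.symm ?_ (step _ _ _ B₁) (step _ _ _ B₂)
      rintro v rfl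
      exact fun h => hna h.symm

theorem localChordalize_adj {G : SimpleGraph V} {u x y : V} :
    (localChordalize G u).Adj x y ↔
      G.Adj x y ∨ (x ≠ y ∧ ((x = u ∧ OnHole G u y) ∨ (y = u ∧ OnHole G u x))) := by
  simp only [localChordalize, SimpleGraph.sup_adj, SimpleGraph.fromRel_adj, OnHole]

/-- No hole of the local chordalization by `u` contains `u`. -/
theorem no_hole_through {G : SimpleGraph V} {u : V} (hNC : VertexNC G u) {a : V}
    {w : (localChordalize G u).Walk a a} (hw : IsHole (localChordalize G u) w) :
    u ∉ w.support := by
  intro hu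
  obtain ⟨n, h, hn, h0, hsup, hinj, hadj⟩ := hole_fun hw hu
  have hne : ∀ i, 1 ≤ i → i < n → h i ≠ u := by
    intro i hi hi' he
    rw [← h0] at he
    have := hinj _ _ hi' (by omega) he
    omega
  have hG : ∀ i j, 1 ≤ i → 1 ≤ j → i < n → j < n → (localChordalize G u).Adj (h i) (h j) →
      G.Adj (h i) (h j) := by
    intro i j hi hj hi' hj' hij
    rcases localChordalize_adj.1 hij with h1 | ⟨_, ⟨h1, _⟩ | ⟨h1, _⟩⟩
    · exact h1
    · exact absurd h1 (hne i hi hi')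
    · exact absurd h1 (hne j hj hj')
  have hsucc : ∀ i, 1 ≤ i → i + 1 < n → G.Adj (h i) (h (i + 1)) := by
    intro i hi hi'
    apply hG i (i + 1) hi (by omega) (by omega) hi'
    rw [hadj _ _ (by omega) (by omega)]
    omega
  have hnu : ∀ i, 2 ≤ i → i ≤ n - 2 → ¬ (localChordalize G u).Adj u (h i) := by
    intro i hi hi'
    have h1 := hadj 0 i (by omega) (by omega)
    rw [h0] at h1
    rw [h1]
    omega
  have hend : ∀ i, 1 ≤ i → i < n → (localChordalize G u).Adj (h 0) (h i) →
      G.Adj u (h i) ∨ OnHole G u (h i) := by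
    intro i hi hi' h1
    rw [h0] at h1
    rcases localChordalize_adj.1 h1 with h1 | ⟨_, ⟨_, h1⟩ | ⟨h1, _⟩⟩
    · exact Or.inl h1
    · exact Or.inr h1
    · exact absurd h1 (hne i hi hi')
  refine core hNC (D := {v | ∃ i, 2 ≤ i ∧ i ≤ n - 2 ∧ h i = v}) (x := h 1) (y := h (n - 1))
    (interval_conn h 2 (n - 2) fun i hi hi' => hsucc i (by omega) (by omega)) ?_ ?_ ?_
    (hne 1 le_rfl (by omega)) (hne (n - 1) (by omega) (by omega)) ?_ ?_ ?_ ?_ ?_ ?_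
  · rintro ⟨i, hi, hi', h1⟩
    exact hne i (by omega) (by omega) h1
  · rintro _ ⟨i, hi, hi', rfl⟩ h1
    exact hnu i hi hi' (localChordalize_adj.2 (Or.inl h1))
  · rintro _ ⟨i, hi, hi', rfl⟩ h1
    exact hnu i hi hi' (localChordalize_adj.2 (Or.inr
      ⟨(hne i (by omega) (by omega)).symm, Or.inl ⟨rfl, h1⟩⟩))
  · intro h1
    have := hinj _ _ (by omega) (by omega) h1
    omega
  · intro h1
    have h2 := (hadj 1 (n - 1) (by omega) (by omega)).1 (localChordalize_adj.2 (Or.inl h1))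
    omega
  · exact ⟨h 1, rfl, h 2, ⟨2, by omega, by omega, rfl⟩, Or.inr (hsucc 1 (by omega) (by omega))⟩
  · refine ⟨h (n - 1), rfl, h (n - 2), ⟨n - 2, by omega, by omega, rfl⟩, Or.inr ?_⟩
    have := hsucc (n - 2) (by omega) (by omega)
    rw [show n - 2 + 1 = n - 1 by omega] at this
    exact this.symm
  · exact hend 1 le_rfl (by omega) (by rw [hadj _ _ (by omega) (by omega)]; omega)
  · exact hend (n - 1) (by omega) (by omega) (by rw [hadj _ _ (by omega) (by omega)]; omega)

/-- Holes of the local chordalization are holes of the original graph. -/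
theorem hole_of_localChordalize {G : SimpleGraph V} {u : V} (hNC : VertexNC G u) {a : V}
    {w : (localChordalize G u).Walk a a} (hw : IsHole (localChordalize G u) w) :
    ∃ w' : G.Walk a a, IsHole G w' ∧ w'.edges = w.edges ∧ w'.support = w.support := by
  have hu := no_hole_through hNC hw
  have he : ∀ e ∈ w.edges, e ∈ G.edgeSet := by
    intro e
    induction e using Sym2.ind with
    | _ x y =>
      intro he
      have hx := w.fst_mem_support_of_mem_edges he
      have hy := w.snd_mem_support_of_mem_edges he
      rcases localChordalize_adj.1 (w.adj_of_mem_edges he) with h1 | ⟨_, ⟨h1, _⟩ | ⟨h1, _⟩⟩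
      · exact h1
      · exact absurd (h1 ▸ hx) hu
      · exact absurd (h1 ▸ hy) hu
  refine ⟨w.transfer G he, ⟨hw.1.transfer he, ?_, ?_⟩, w.edges_transfer he, w.support_transfer he⟩
  · rw [Walk.length_transfer]
    exact hw.2.1
  · intro x y hx hy hadj
    rw [Walk.support_transfer] at hx hy
    rw [Walk.edges_transfer]
    exact hw.2.2 x y hx hy (localChordalize_adj.2 (Or.inl hadj))

theorem chordalizeList_adj (l : List V) : ∀ (G : SimpleGraph V), (∀ v ∈ l, VertexNC G v) →
    ∀ x y, (chordalizeList G l).Adj x y →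
      G.Adj x y ∨ ∃ v ∈ l, (x = v ∧ OnHole G v y) ∨ (y = v ∧ OnHole G v x) := by
  induction l with
  | nil => exact fun G _ x y h => Or.inl h
  | cons u l ih =>
    intro G hNC x y h
    have hu : VertexNC G u := hNC u (by simp)
    have hon : ∀ v z, OnHole (localChordalize G u) v z → OnHole G v z := by
      rintro v z ⟨a, w, hw, h1, h2⟩
      obtain ⟨w', hw', _, hs⟩ := hole_of_localChordalize hu hw
      exact ⟨a, w', hw', hs ▸ h1, hs ▸ h2⟩
    have hNC' : ∀ v ∈ l, VertexNC (localChordalize G u) v := by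
      intro v hv a b w₁ w₂ h₁ h₂ hm₁ hm₂
      obtain ⟨w₁', h₁', he₁, hs₁⟩ := hole_of_localChordalize hu h₁
      obtain ⟨w₂', h₂', he₂, hs₂⟩ := hole_of_localChordalize hu h₂
      rw [← he₁, ← he₂]
      rw [← hs₁] at hm₁
      rw [← hs₂] at hm₂
      exact hNC v (by simp [hv]) a b w₁' w₂' h₁' h₂' hm₁ hm₂
    rcases ih (localChordalize G u) hNC' x y h with h | ⟨v, hv, h⟩
    · rcases localChordalize_adj.1 h with h | ⟨_, h⟩
      · exact Or.inl h
      · exact Or.inr ⟨u, by simp, h⟩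
    · exact Or.inr ⟨v, by simp [hv], h.imp (And.imp_right (hon _ _)) (And.imp_right (hon _ _))⟩

theorem clique_aux {G : SimpleGraph V} {C : Set V} (hNC : SetNC G C) {u u' v : V} (hu : u ∈ C)
    (hu' : u' ∈ C) (huu : G.Adj u u') (hv : v ≠ u) (hv' : v ≠ u') (hna : ¬ G.Adj u v)
    (hna' : ¬ G.Adj u' v) (hH : OnHole G u v) (hH' : OnHole G u' v) : False := by
  have half : ∀ u u', u ∈ C → u' ∈ C → G.Adj u u' → v ≠ u → v ≠ u' → ¬ G.Adj u v →
      ¬ G.Adj u' v → OnHole G u v → ∃ L m n, Arm G u v L m n ∧ ¬ Touch G L {u'} := by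
    rintro u u' hu hu' huu hv hv' hna hna' ⟨a, w, hw, huw, hvw⟩
    obtain ⟨L₁, m₁, n₁, L₂, m₂, n₂, A₁, A₂, hL, hw₁, hw₂⟩ := exists_arms hw huw hvw hv hna
    by_cases h₁ : Touch G L₁ {u'}
    · refine ⟨L₂, m₂, n₂, A₂, fun h₂ => ?_⟩
      refine not_touch_both (hNC.1 u hu) hw huw hvw hv A₁ A₂ hL hw₁ hw₂ (CSet.singleton u')
        huu.ne hv' ?_ h₁ h₂
      rintro z rfl h
      exact hna' h.symm
    · exact ⟨L₁, m₁, n₁, A₁, h₁⟩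
  obtain ⟨L, m, n, A, hA⟩ := half u u' hu hu' huu hv hv' hna hna' hH
  obtain ⟨R, k, l, B, hB⟩ := half u' u hu' hu huu.symm hv' hv hna' hna hH'
  obtain ⟨c1, c2, c3, c4⟩ := A.closed hna hv
  have d1 : CSet G (R ∪ {u'}) :=
    B.conn.union (CSet.singleton u') ⟨k, B.mL, u', rfl, Or.inr B.um.symm⟩
  have hcs := c1.union d1 ⟨v, Or.inr rfl, l, Or.inl B.nL, Or.inr B.xn⟩
  obtain ⟨p, hp, w, hw, hs⟩ := exists_hole A.um huu
    (fun h => hA ⟨m, A.mL, u', rfl, Or.inl h⟩) (fun h => hA ⟨m, A.mL, u', rfl, Or.inr h⟩)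
    (hcs m (Or.inl c2) u' (Or.inr (Or.inr rfl)))
    (by
      rintro (h | h | h)
      · exact c4 h
      · exact hB ⟨u, h, u, rfl, Or.inl rfl⟩
      · exact huu.ne h)
    (by
      rintro z (h | h | h) hz
      · exact Or.inl (c3 z h hz)
      · exact absurd ⟨z, h, u, rfl, Or.inr hz.symm⟩ hB
      · exact Or.inr h)
  exact huu.ne (hNC.2 u w hw u hu u' hu' ((hs _).2 (Or.inl rfl))
    ((hs _).2 (Or.inr p.end_mem_support)))

/-- if `K` is a clique of `Ĝ(C)` that is not a clique of `G`, then
there is `u ∈ K ∩ C` with `K \ {u}` a clique of `G`. -/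
theorem stmt7 {V : Type*} [Fintype V] [DecidableEq V] (G : SimpleGraph V) (C : Set V)
    (hcov : IsHoleCover G C) (hNC : SetNC G C)
    (l : List V) (hl : l.Nodup) (hlC : {v | v ∈ l} = C)
    (K : Set V) (hK : (chordalizeList G l).IsClique K) (hKG : ¬ G.IsClique K) :
    ∃ u ∈ K ∩ C, G.IsClique (K \ {u}) := by
  classical
  have huniq : ∀ u ∈ C, ∀ v ∈ C, OnHole G u v → u = v := by
    rintro u hu v hv ⟨a, w, hw, h1, h2⟩
    exact hNC.2 a w hw u hu v hv h1 h2
  have hnonadj : ∀ x ∈ K, ∀ y ∈ K, x ≠ y → ¬ G.Adj x y →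
      (x ∈ C ∧ OnHole G x y) ∨ (y ∈ C ∧ OnHole G y x) := by
    intro x hx y hy hxy hna
    rcases chordalizeList_adj l G (fun v hv => hNC.1 v (by rw [← hlC]; exact hv)) x y
      (hK hx hy hxy) with h | ⟨v, hv, ⟨rfl, h⟩ | ⟨rfl, h⟩⟩
    · exact absurd h hna
    · exact Or.inl ⟨by rw [← hlC]; exact hv, h⟩
    · exact Or.inr ⟨by rw [← hlC]; exact hv, h⟩
  have hbad : ∀ K' ⊆ K, ¬ G.IsClique K' → ∃ u v, u ∈ K' ∧ v ∈ K' ∧ u ∈ C ∧ v ≠ u ∧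
      ¬ G.Adj u v ∧ OnHole G u v := by
    intro K' hK' hnc
    have : ∃ x ∈ K', ∃ y ∈ K', x ≠ y ∧ ¬ G.Adj x y := by
      by_contra hcon
      push Not at hcon
      exact hnc fun x hx y hy hxy => hcon x hx y hy hxy
    obtain ⟨x, hx, y, hy, hxy, hna⟩ := this
    rcases hnonadj x (hK' hx) y (hK' hy) hxy hna with ⟨h1, h2⟩ | ⟨h1, h2⟩
    · exact ⟨x, y, hx, hy, h1, hxy.symm, hna, h2⟩
    · exact ⟨y, x, hy, hx, h1, hxy, fun h => hna h.symm, h2⟩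
  obtain ⟨u, v, huK, hvK, huC, hvu, hna, hH⟩ := hbad K subset_rfl hKG
  refine ⟨u, ⟨huK, huC⟩, ?_⟩
  by_contra hcon
  obtain ⟨u', v', ⟨huK', huu⟩, ⟨hvK', hvu2⟩, huC', hvu', hna', hH'⟩ :=
    hbad (K \ {u}) Set.sdiff_subset hcon
  rw [Set.mem_singleton_iff] at huu hvu2
  have hvC : v ∉ C := fun h => hvu (huniq u huC v h hH).symm
  have hvC' : v' ∉ C := fun h => hvu' (huniq u' huC' v' h hH').symm
  have hadj : G.Adj u u' := by
    by_contra h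
    rcases hnonadj u huK u' huK' (Ne.symm huu) h with ⟨_, h⟩ | ⟨_, h⟩
    · exact huu (huniq _ huC _ huC' h).symm
    · exact huu (huniq _ huC' _ huC h)
  have hvu3 : v ≠ u' := fun h => hvC (h ▸ huC')
  have h1 : G.Adj u v' := by
    by_contra h
    rcases hnonadj u huK v' hvK' (Ne.symm hvu2) h with ⟨_, h2⟩ | ⟨h2, _⟩
    · exact clique_aux hNC huC huC' hadj hvu2 hvu' h hna' h2 hH'
    · exact hvC' h2
  have h2 : G.Adj u' v := by
    by_contra h
    rcases hnonadj u' huK' v hvK (Ne.symm hvu3) h with ⟨_, h2⟩ | ⟨h2, _⟩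
    · exact clique_aux hNC huC huC' hadj hvu hvu3 hna h hH h2
    · exact hvC h2
  have hvv : v ≠ v' := fun h => hna (h ▸ h1)
  have h3 : G.Adj v v' := by
    by_contra h
    rcases hnonadj v hvK v' hvK' hvv h with ⟨h2, _⟩ | ⟨h2, _⟩
    · exact hvC h2
    · exact hvC' h2
  obtain ⟨p, hp, w, hw, hs⟩ := exists_hole (T := {u', v, v'}) hadj h1 (Ne.symm hvu') hna'
    ((ConnIn.edge (b := v) (by simp) (by simp) (Or.inr h2)).trans
      (ConnIn.edge (by simp) (by simp) (Or.inr h3)))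
    (by
      rintro (h | h | h)
      · exact huu h.symm
      · exact hvu h.symm
      · exact hvu2 h.symm)
    (by
      rintro z (rfl | rfl | h) hz
      · exact Or.inl rfl
      · exact absurd hz hna
      · exact Or.inr h)
  exact hadj.ne (hNC.2 u w hw u huC u' huC' ((hs _).2 (Or.inl rfl))
    ((hs _).2 (Or.inr p.start_mem_support)))
end

section
/- Let G be a finite simple graph with a hole cover C satisfying the NC property. Then for every clique K of Ĝ(C), the complete graph on |K| vertices is a minor of G. -/
open SimpleGraph

variable {V : Type*}

/-- Hole presented as a cyclic sequence. -/
def HSeq (G : SimpleGraph V) (n : ℕ) (p : ℕ → V) : Prop :=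
  4 ≤ n ∧ p n = p 0 ∧ (∀ i j, i < n → j < n → p i = p j → i = j) ∧
    (∀ i, i < n → G.Adj (p i) (p (i + 1))) ∧
    ∀ i j, i < j → j < n → G.Adj (p i) (p j) → j = i + 1 ∨ (i = 0 ∧ j + 1 = n)

lemma HSeq.reverse {G : SimpleGraph V} {n : ℕ} {p : ℕ → V} (h : HSeq G n p) :
    HSeq G n (fun i => p (n - i)) := by
  obtain ⟨h4, hc, hinj, hadj, hind⟩ := h
  refine ⟨h4, by simp [hc], ?_, ?_, ?_⟩
  · intro i j hi hj hij
    simp only at hij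
    rcases Nat.eq_zero_or_pos i with h0 | h0 <;> rcases Nat.eq_zero_or_pos j with h1 | h1
    · omega
    · subst h0
      have := hinj 0 (n - j) (by omega) (by omega) (by simpa [hc] using hij)
      omega
    · subst h1
      have := hinj (n - i) 0 (by omega) (by omega) (by simpa [hc] using hij)
      omega
    · have := hinj _ _ (by omega) (by omega) hij
      omega
  · intro i hi
    have := hadj (n - (i + 1)) (by omega)
    rw [show n - (i + 1) + 1 = n - i by omega] at this
    exact this.symm
  · intro i j hij hj ha
    simp only at ha
    rcases Nat.eq_zero_or_pos i with h0 | h0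
    · subst h0
      have := hind 0 (n - j) (by omega) (by omega) (by simpa [hc] using ha)
      omega
    · have := hind (n - j) (n - i) (by omega) (by omega) ha.symm
      omega

lemma HSeq.rotate {G : SimpleGraph V} {n : ℕ} {p : ℕ → V} (h : HSeq G n p) {k : ℕ} (hk : k < n) :
    HSeq G n (fun i => if i + k < n then p (i + k) else p (i + k - n)) := by
  obtain ⟨h4, hc, hinj, hadj, hind⟩ := h
  refine ⟨h4, by simp [hk], ?_, ?_, ?_⟩
  · intro i j hi hj hij
    simp only at hij
    split_ifs at hij <;> have := hinj _ _ (by omega) (by omega) hij <;> omega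
  · intro i hi
    simp only
    split_ifs with h1 h2 h2
    · simpa [Nat.add_right_comm] using hadj (i + k) h1
    · have := hadj (i + k) h1
      rw [show i + k + 1 = n by omega, hc] at this
      rwa [show i + 1 + k - n = 0 by omega]
    · omega
    · have := hadj (i + k - n) (by omega)
      rwa [show i + k - n + 1 = i + 1 + k - n by omega] at this
  · intro i j hij hj ha
    simp only at ha
    split_ifs at ha
    · have := hind _ _ (by omega) (by omega) ha
      omega
    · have := hind _ _ (by omega) (by omega) ha.symm
      omega
    · omega
    · have := hind _ _ (by omega) (by omega) ha
      omega

lemma hseq_of_walk {G : SimpleGraph V} {a : V} {w : G.Walk a a} (h : IsHole G w) :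
    HSeq G w.length w.getVert := by
  obtain ⟨hc, h4, hch⟩ := h
  have hinj : ∀ i j, i < w.length → j < w.length → w.getVert i = w.getVert j → i = j := by
    intro i j hi hj hij
    exact hc.getVert_injOn' (by simp only [Set.mem_ofPred_eq]; omega)
      (by simp only [Set.mem_ofPred_eq]; omega) hij
  refine ⟨h4, by simp, hinj, fun i hi => w.adj_getVert_succ hi, ?_⟩
  intro i j hij hj ha
  have hm := hch _ _ (w.getVert_mem_support i) (w.getVert_mem_support j) ha
  rw [Walk.mk_mem_edges_iff_exists] at hm
  obtain ⟨t, ht, he⟩ := hm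
  have key : ∀ x, x < w.length → w.getVert x = w.getVert (t + 1) →
      x = t + 1 ∨ (x = 0 ∧ t + 1 = w.length) := by
    intro x hx hxe
    by_cases h1 : t + 1 < w.length
    · left; exact hinj _ _ hx h1 hxe
    · right
      have h2 : t + 1 = w.length := by omega
      refine ⟨hinj _ _ hx (by omega) ?_, h2⟩
      rw [hxe, h2]; simp
  rw [Sym2.eq_iff] at he
  rcases he with ⟨h1, h2⟩ | ⟨h1, h2⟩
  · have e1 := hinj _ _ (by omega) (by omega) h1
    have e2 := key _ (by omega) h2.symm
    omega
  · have e1 := hinj _ _ (by omega) (by omega) h1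
    have e2 := key _ (by omega) h2.symm
    omega

lemma walk_of_seq {G : SimpleGraph V} (n : ℕ) : ∀ (p : ℕ → V),
    (∀ i, i < n → G.Adj (p i) (p (i + 1))) →
    ∃ w : G.Walk (p 0) (p n), w.length = n ∧ ∀ i, i ≤ n → w.getVert i = p i := by
  induction n with
  | zero => intro p _; exact ⟨Walk.nil, rfl, by intro i hi; simp [Nat.le_zero.mp hi]⟩
  | succ n ih =>
    intro p hp
    obtain ⟨w, hw, hv⟩ := ih (fun i => p (i + 1)) (fun i hi => hp (i + 1) (by omega))
    refine ⟨Walk.cons (hp 0 (by omega)) w, by simp [hw], ?_⟩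
    intro i hi
    rcases i with _ | i
    · simp
    · rw [Walk.getVert_cons_succ]
      exact hv i (by omega)

lemma walk_of_hseq {G : SimpleGraph V} {n : ℕ} {p : ℕ → V} (h : HSeq G n p) :
    ∃ (w : G.Walk (p 0) (p 0)), IsHole G w ∧ (∀ y, y ∈ w.support ↔ ∃ i < n, p i = y) ∧
      ∀ i < n, s(p i, p (i + 1)) ∈ w.edges := by
  obtain ⟨h4, hc, hinj, hadj, hind⟩ := h
  obtain ⟨m, rfl⟩ : ∃ m, n = m + 1 := ⟨n - 1, by omega⟩
  have hww : ∃ w : G.Walk (p 1) (p 0), w.length = m ∧ ∀ i, i ≤ m → w.getVert i = p (i + 1) := by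
    rw [← hc]
    exact walk_of_seq m (fun i => p (i + 1)) (fun i hi => hadj (i + 1) (by omega))
  obtain ⟨w, hw, hv⟩ := hww
  have hinj' : ∀ i j, i ≤ m → j ≤ m → p (i + 1) = p (j + 1) → i = j := by
    intro i j hi hj hij
    by_cases h1 : i = m <;> by_cases h2 : j = m
    · omega
    · rw [h1, hc] at hij
      have := hinj _ _ (by omega) (by omega) hij; omega
    · rw [h2, hc] at hij
      have := hinj _ _ (by omega) (by omega) hij; omega
    · have := hinj _ _ (by omega) (by omega) hij; omega
  have hpath : w.IsPath := by
    rw [← Walk.IsPath.getVert_injOn_iff]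
    intro i hi j hj hij
    simp only [Set.mem_ofPred_eq, hw] at hi hj
    rw [hv i hi, hv j hj] at hij
    exact hinj' i j hi hj hij
  let W : G.Walk (p 0) (p 0) := Walk.cons (hadj 0 (by omega)) w
  have hWl : W.length = m + 1 := by simp [W, hw]
  have hWv : ∀ i, i ≤ m + 1 → W.getVert i = p i := by
    intro i hi
    rcases i with _ | i
    · simp
    · show (Walk.cons _ w).getVert (i + 1) = _
      rw [Walk.getVert_cons_succ]; exact hv i (by omega)
  have hsup : ∀ y, y ∈ W.support ↔ ∃ i < m + 1, p i = y := by
    intro y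
    rw [Walk.mem_support_iff_exists_getVert]
    constructor
    · rintro ⟨i, hi, hil⟩
      rw [hWl] at hil
      rw [hWv i hil] at hi
      by_cases h1 : i < m + 1
      · exact ⟨i, h1, hi⟩
      · exact ⟨0, by omega, by rw [← hi, ← hc]; congr 1; omega⟩
    · rintro ⟨i, hi, rfl⟩
      exact ⟨i, hWv i (by omega), by omega⟩
  have hedge : ∀ i < m + 1, s(p i, p (i + 1)) ∈ W.edges := by
    intro i hi
    rw [Walk.mk_mem_edges_iff_exists]
    exact ⟨i, by omega, by rw [hWv i (by omega), hWv (i + 1) (by omega)]⟩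
  refine ⟨W, ⟨?_, by omega, ?_⟩, hsup, hedge⟩
  · rw [Walk.cons_isCycle_iff]
    refine ⟨hpath, ?_⟩
    rw [Walk.mk_mem_edges_iff_exists]
    rintro ⟨t, ht, he⟩
    rw [hw] at ht
    rw [hv t (by omega), hv (t + 1) (by omega), Sym2.eq_iff] at he
    have e0 : p 0 = p (m + 1) := hc.symm
    rcases he with ⟨a, b⟩ | ⟨a, b⟩
    · have := hinj' 0 (t + 1) (by omega) (by omega) b.symm
      omega
    · have h1 := hinj' 0 t (by omega) (by omega) a.symm
      have h2 := hinj' m (t + 1) (by omega) (by omega) (by rw [← e0]; exact b.symm)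
      omega
  · intro x y hx hy ha
    obtain ⟨i, hi, rfl⟩ := (hsup x).1 hx
    obtain ⟨j, hj, rfl⟩ := (hsup y).1 hy
    have aux : ∀ i j, i < j → j < m + 1 → G.Adj (p i) (p j) → s(p i, p j) ∈ W.edges := by
      intro i j hij hj ha
      rcases hind i j hij hj ha with h1 | ⟨h1, h2⟩
      · rw [h1]; exact hedge i (by omega)
      · have := hedge j hj
        rw [h2, hc] at this
        rw [h1, Sym2.eq_swap]; exact this
    rcases lt_trichotomy i j with h1 | h1 | h1
    · exact aux i j h1 hj ha
    · subst h1; exact absurd ha (G.irrefl)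
    · rw [Sym2.eq_swap]; exact aux j i h1 hi ha.symm

lemma hole_build {G : SimpleGraph V} {s : ℕ} {v : ℕ → V} {D : Set V} (hs1 : 1 ≤ s)
    (vinj : ∀ i j, i ≤ s → j ≤ s → v i = v j → i = j)
    (vadj : ∀ i, i < s → G.Adj (v i) (v (i + 1)))
    (vind : ∀ i j, i < j → j ≤ s → G.Adj (v i) (v j) → j = i + 1)
    (hD : (G.induce D).Preconnected) (hdis : ∀ i, i ≤ s → v i ∉ D)
    (hint : ∀ i, 0 < i → i < s → ∀ d ∈ D, ¬ G.Adj (v i) d)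
    (h0 : ∃ d ∈ D, G.Adj (v 0) d) (hs : ∃ d ∈ D, G.Adj (v s) d)
    (hbig : 2 ≤ s ∨ ∀ d ∈ D, G.Adj (v 0) d → ¬ G.Adj (v s) d) :
    ∃ n q, HSeq G n q ∧ (∀ i, i ≤ s → q i = v i) ∧ s + 1 < n ∧
      ∀ i, s < i → i < n → q i ∈ D := by
  classical
  -- existence of some linking sequence
  have hex : ∃ t, ∃ d : ℕ → V, (∀ i, i ≤ t → d i ∈ D) ∧ (∀ i, i < t → G.Adj (d i) (d (i + 1))) ∧
      G.Adj (v s) (d 0) ∧ G.Adj (d t) (v 0) := by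
    obtain ⟨a, ha, ha'⟩ := hs
    obtain ⟨b, hb, hb'⟩ := h0
    obtain ⟨w⟩ := hD ⟨a, ha⟩ ⟨b, hb⟩
    refine ⟨w.length, fun i => (w.getVert i : V), fun i _ => (w.getVert i).2, ?_, ?_, ?_⟩
    · intro i hi
      exact w.adj_getVert_succ hi
    · simpa using ha'
    · simpa using hb'.symm
  obtain ⟨d, hdD, hdadj, hd0, hdt⟩ := Nat.find_spec hex
  have hmin := fun m (hm : m < Nat.find hex) => Nat.find_min hex hm
  generalize Nat.find hex = t at *
  -- shortcuts
  have hcut : ∀ i j, i < j → j ≤ t → G.Adj (d i) (d j) → j = i + 1 := by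
    intro i j hij hj ha
    by_contra hne
    refine hmin (t - (j - i - 1)) (by omega)
      ⟨fun k => if k ≤ i then d k else d (k + (j - i - 1)), ?_, ?_, ?_, ?_⟩
    · intro k hk
      simp only; split_ifs <;> apply hdD <;> omega
    · intro k hk
      simp only
      split_ifs with h1 h2 h2
      · exact hdadj k (by omega)
      · rw [show k = i by omega, show i + 1 + (j - i - 1) = j by omega]; exact ha
      · omega
      · have := hdadj (k + (j - i - 1)) (by omega)
        rwa [show k + (j - i - 1) + 1 = k + 1 + (j - i - 1) by omega] at this
    · simpa using hd0
    · simp only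
      rw [if_neg (by omega), show t - (j - i - 1) + (j - i - 1) = t by omega]; exact hdt
  have hdS : ∀ j, j ≤ t → G.Adj (v s) (d j) → j = 0 := by
    intro j hj ha
    by_contra hne
    refine hmin (t - j) (by omega) ⟨fun k => d (k + j), ?_, ?_, ?_, ?_⟩
    · intro k hk; exact hdD _ (by omega)
    · intro k hk
      have := hdadj (k + j) (by omega)
      rwa [show k + j + 1 = k + 1 + j by omega] at this
    · simpa using ha
    · simp only; rw [show t - j + j = t by omega]; exact hdt
  have hdE : ∀ j, j ≤ t → G.Adj (v 0) (d j) → j = t := by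
    intro j hj ha
    by_contra hne
    exact hmin j (by omega) ⟨d, fun i hi => hdD i (by omega), fun i hi => hdadj i (by omega),
      hd0, ha.symm⟩
  have hdinj : ∀ i j, i < j → j ≤ t → d i ≠ d j := by
    intro i j hij hj he
    by_cases hjt : j = t
    · subst hjt
      have := hdE i (by omega) (by rw [he]; exact hdt.symm)
      omega
    · have h1 := hdadj j (by omega)
      rw [← he] at h1
      have := hcut i (j + 1) (by omega) (by omega) h1
      omega
  have hst : 3 ≤ s + t + 1 := by
    rcases hbig with h | h
    · omega
    · have : t ≠ 0 := by
        rintro rfl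
        exact h _ (hdD 0 (le_refl _)) hdt.symm hd0
      omega
  refine ⟨s + t + 2, fun i => if i ≤ s then v i else if i ≤ s + t + 1 then d (i - (s + 1)) else v 0,
    ⟨by omega, ?_, ?_, ?_, ?_⟩, ?_, by omega, ?_⟩
  · simp only
    rw [if_neg (by omega), if_neg (by omega), if_pos (by omega)]
  · have aux : ∀ i j, i ≤ s → j ≤ t → v i ≠ d j := by
      intro i j hi hj he
      exact hdis i hi (he ▸ hdD j hj)
    intro i j hi hj hij
    simp only at hij
    split_ifs at hij
    · exact vinj _ _ (by omega) (by omega) hij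
    · exact absurd hij (aux _ _ (by omega) (by omega))
    · omega
    · exact absurd hij.symm (aux _ _ (by omega) (by omega))
    · by_contra hne
      rcases Nat.lt_or_gt_of_ne hne with h | h
      · exact hdinj (i - (s + 1)) (j - (s + 1)) (by omega) (by omega) hij
      · exact hdinj (j - (s + 1)) (i - (s + 1)) (by omega) (by omega) hij.symm
    all_goals omega
  · intro i hi
    simp only
    split_ifs
    all_goals first | omega | skip
    · exact vadj _ (by omega)
    · rw [show i = s by omega, show s + 1 - (s + 1) = 0 by omega]; exact hd0
    · have := hdadj (i - (s + 1)) (by omega)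
      rwa [show i - (s + 1) + 1 = i + 1 - (s + 1) by omega] at this
    · rw [show i - (s + 1) = t by omega]; exact hdt
  · intro i j hij hj ha
    simp only at ha
    split_ifs at ha
    all_goals first | omega | skip
    · left; exact vind _ _ hij (by omega) ha
    · by_cases h1 : i = 0
      · subst h1
        have := hdE _ (by omega) ha
        right; omega
      · by_cases h2 : i = s
        · subst h2
          have := hdS _ (by omega) ha
          left; omega
        · exact absurd ha (hint i (by omega) (by omega) _ (hdD _ (by omega)))
    · have := hcut _ _ (by omega) (by omega) ha
      left; omega
  · intro i hi
    simp [hi]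
  · intro i h1 h2
    simp only
    rw [if_neg (by omega), if_pos (by omega)]
    exact hdD _ (by omega)

/-- `y` lies on a hole through `u`. -/
def OnH (G : SimpleGraph V) (u y : V) : Prop :=
  ∃ n p i, HSeq G n p ∧ p 0 = u ∧ i < n ∧ p i = y

/-- Sequence version of the NC property of a vertex. -/
def NCs (G : SimpleGraph V) (u : V) : Prop :=
  ∀ n p m q, HSeq G n p → HSeq G m q → p 0 = u → (∀ t, t < m → q t ≠ u) →
    ∀ i t, i + 2 ≤ n → t + 2 ≤ m → p i = q t → p (i + 1) = q (t + 1) → p (i + 2) = q (t + 2) → False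

lemma HSeq.onH {G : SimpleGraph V} {n : ℕ} {p : ℕ → V} (h : HSeq G n p) {i j : ℕ}
    (hi : i < n) (hj : j < n) : OnH G (p i) (p j) := by
  refine ⟨n, _, if i ≤ j then j - i else j + n - i, h.rotate hi, by simp [hi], ?_, ?_⟩
  · split_ifs <;> omega
  · split_ifs <;> first | omega | (congr 1; omega)

lemma nc_of_vertexNC {G : SimpleGraph V} {u : V} (h : VertexNC G u) : NCs G u := by
  intro n p m q hp hq h0 hu i t hi ht e1 e2 e3
  obtain ⟨w, hw, hws, hwe⟩ := walk_of_hseq hp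
  obtain ⟨z, hz, hzs, hze⟩ := walk_of_hseq hq
  have h4 := hp.1
  refine h _ _ w z hw hz ((hws u).2 ⟨0, by omega, h0⟩) ?_
    ⟨p i, p (i + 1), p (i + 2), ?_, hwe i (by omega), hwe (i + 1) (by omega), ?_, ?_⟩
  · intro hh
    obtain ⟨t, ht, he⟩ := (hzs u).1 hh
    exact hu t ht he
  · intro he
    by_cases h1 : i + 2 < n
    · have := hp.2.2.1 _ _ (by omega) h1 he; omega
    · rw [show i + 2 = n by omega, hp.2.1] at he
      have := hp.2.2.1 _ _ (by omega) (by omega) he; omega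
  · rw [e1, e2]; exact hze t (by omega)
  · rw [e2, e3]; exact hze (t + 1) (by omega)

lemma lc_adj {G : SimpleGraph V} {u x y : V} : (localChordalize G u).Adj x y ↔
    G.Adj x y ∨ (x ≠ y ∧ ((x = u ∧ OnH G u y) ∨ (y = u ∧ OnH G u x))) := by
  have key : ∀ y, (∃ (a : V) (w : G.Walk a a), IsHole G w ∧ u ∈ w.support ∧ y ∈ w.support) ↔
      OnH G u y := by
    intro y
    constructor
    · rintro ⟨a, w, hw, hu, hy⟩
      have hs := hseq_of_walk hw
      have aux : ∀ z, z ∈ w.support → ∃ i < w.length, w.getVert i = z := by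
        intro z hz
        obtain ⟨i, hi, hil⟩ := Walk.mem_support_iff_exists_getVert.1 hz
        by_cases h1 : i < w.length
        · exact ⟨i, h1, hi⟩
        · refine ⟨0, by have := hs.1; omega, ?_⟩
          rw [← hi, show i = w.length by omega]; simp
      obtain ⟨i, hi, rfl⟩ := aux u hu
      obtain ⟨j, hj, rfl⟩ := aux y hy
      exact hs.onH hi hj
    · rintro ⟨n, p, i, hp, h0, hi, hy⟩
      obtain ⟨w, hw, hws, _⟩ := walk_of_hseq hp
      exact ⟨_, w, hw, (hws u).2 ⟨0, by omega, h0⟩, (hws y).2 ⟨i, hi, hy⟩⟩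
  simp only [localChordalize, SimpleGraph.sup_adj, SimpleGraph.fromRel_adj, key]

lemma arc_conn {G : SimpleGraph V} {p : ℕ → V} {a b : ℕ} (hab : a ≤ b)
    (h : ∀ i, a ≤ i → i < b → G.Adj (p i) (p (i + 1))) :
    (G.induce {z | ∃ i, a ≤ i ∧ i ≤ b ∧ p i = z}).Connected := by
  obtain ⟨w, hw, hv⟩ := walk_of_seq (G := G) (b - a) (fun i => p (a + i))
    (fun i hi => h (a + i) (by omega) (by omega))
  have : {z | ∃ i, a ≤ i ∧ i ≤ b ∧ p i = z} = {z | z ∈ w.support} := by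
    ext z
    simp only [Set.mem_ofPred_eq, Walk.mem_support_iff_exists_getVert, hw]
    constructor
    · rintro ⟨i, h1, h2, rfl⟩
      refine ⟨i - a, ?_, by omega⟩
      rw [hv _ (by omega)]; congr 1; omega
    · rintro ⟨i, h1, h2⟩
      exact ⟨a + i, by omega, by omega, by rw [← h1, hv i h2]⟩
  rw [this]
  exact w.connected_induce_support

lemma side {G : SimpleGraph V} {u : V} {n : ℕ} {p : ℕ → V} {i : ℕ} {D : Set V}
    (hnc : NCs G u) (h : HSeq G n p) (h0 : p 0 = u) (hi : 0 < i) (hin : i < n)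
    (hD : (G.induce D).Preconnected) (huD : u ∉ D) (hx : p i ∉ D)
    (hxa : ∀ d ∈ D, ¬ G.Adj (p i) d) :
    ∃ p', HSeq G n p' ∧ p' 0 = u ∧ ∃ i', 0 < i' ∧ i' < n ∧ p' i' = p i ∧
      ∀ t, 0 < t → t ≤ i' → p' t ∉ D ∧ ∀ d ∈ D, ¬ G.Adj (p' t) d := by
  classical
  by_cases A : ∃ e, e < i ∧ (p (i - e) ∈ D ∨ ∃ d ∈ D, G.Adj (p (i - e)) d)
  swap
  · push Not at A
    refine ⟨p, h, h0, i, hi, hin, rfl, ?_⟩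
    intro t ht hti
    have := A (i - t) (by omega)
    rwa [show i - (i - t) = t by omega] at this
  by_cases B : ∃ f, i + f < n ∧ (p (i + f) ∈ D ∨ ∃ d ∈ D, G.Adj (p (i + f)) d)
  swap
  · push Not at B
    refine ⟨_, h.reverse, by simp [h.2.1, h0], n - i, by omega, by omega, ?_, ?_⟩
    · congr 1; omega
    · intro t ht hti
      have := B (n - t - i) (by omega)
      rwa [show i + (n - t - i) = n - t by omega] at this
  exfalso
  obtain ⟨he1, he2⟩ := Nat.find_spec A
  have hem := fun m (hm : m < Nat.find A) => Nat.find_min A hm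
  generalize Nat.find A = e at *
  obtain ⟨hf1, hf2⟩ := Nat.find_spec B
  have hfm := fun m (hm : m < Nat.find B) => Nat.find_min B hm
  generalize Nat.find B = f at *
  obtain ⟨h4, hc, hinj, hadj, hind⟩ := id h
  have hni : ¬ (p i ∈ D ∨ ∃ d ∈ D, G.Adj (p i) d) := by
    rintro (h | ⟨d, hd, h⟩)
    · exact hx h
    · exact hxa d hd h
  have e0 : e ≠ 0 := by
    rintro rfl; exact hni (by simpa using he2)
  have f0 : f ≠ 0 := by
    rintro rfl; exact hni (by simpa using hf2)
  have hjD : p (i - e) ∉ D := by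
    intro hh
    refine hem (e - 1) (by omega) ⟨by omega, Or.inr ⟨_, hh, ?_⟩⟩
    have := hadj (i - e) (by omega)
    rw [show i - e + 1 = i - (e - 1) by omega] at this
    exact this.symm
  have hkD : p (i + f) ∉ D := by
    intro hh
    refine hfm (f - 1) (by omega) ⟨by omega, Or.inr ⟨_, hh, ?_⟩⟩
    have := hadj (i + (f - 1)) (by omega)
    rwa [show i + (f - 1) + 1 = i + f by omega] at this
  have hmid : ∀ t, 0 < t → t < e + f → p (i - e + t) ∉ D ∧ ∀ d ∈ D, ¬ G.Adj (p (i - e + t)) d := by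
    intro t h1 h2
    by_cases h3 : t ≤ e
    · have := hem (e - t) (by omega)
      push Not at this
      have := this (by omega)
      rwa [show i - (e - t) = i - e + t by omega] at this
    · have := hfm (t - e) (by omega)
      push Not at this
      have := this (by omega)
      rwa [show i + (t - e) = i - e + t by omega] at this
  obtain ⟨m, q, hq, hqv, hqm, hqD⟩ := hole_build (G := G) (s := e + f)
    (v := fun t => p (i - e + t)) (D := D) (by omega)
    (by
      intro a b ha hb hab
      have := hinj _ _ (by omega) (by omega) hab
      omega)
    (by
      intro a ha
      exact hadj (i - e + a) (by omega))
    (by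
      intro a b hab hb ha
      have := hind _ _ (by omega) (by omega) ha
      omega)
    hD
    (by
      intro t ht
      by_cases h1 : t = 0
      · subst h1; simpa using hjD
      · by_cases h2 : t = e + f
        · subst h2; rwa [show i - e + (e + f) = i + f by omega]
        · exact (hmid t (by omega) (by omega)).1)
    (by
      intro t h1 h2
      exact (hmid t h1 h2).2)
    (by
      rcases he2 with h | h
      · exact absurd h hjD
      · simpa using h)
    (by
      rw [show i - e + (e + f) = i + f by omega]
      rcases hf2 with h | h
      · exact absurd h hkD
      · exact h)
    (by omega)
  refine hnc n p m q h hq h0 ?_ (i - 1) (e - 1) (by omega) (by omega) ?_ ?_ ?_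
  · intro t ht hqt
    by_cases h1 : t ≤ e + f
    · rw [hqv t h1, ← h0] at hqt
      have := hinj _ _ (by omega) (by omega) hqt
      omega
    · exact huD (hqt ▸ hqD t (by omega) ht)
  · rw [hqv _ (by omega)]; congr 1; omega
  · rw [hqv _ (by omega)]; congr 1; omega
  · rw [hqv _ (by omega)]; congr 1; omega

lemma step_core {G G' : SimpleGraph V} {u : V} (hnc : NCs G u)
    (hG' : ∀ x y, G'.Adj x y ↔
      G.Adj x y ∨ (x ≠ y ∧ ((x = u ∧ OnH G u y) ∨ (y = u ∧ OnH G u x))))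
    {n : ℕ} {q : ℕ → V} (hq : HSeq G' n q) (hq0 : q 0 = u) (hnew : ¬ G.Adj u (q 1)) : False := by
  classical
  obtain ⟨h4, hc, hinj, hadj, hind⟩ := id hq
  have qne : ∀ t, 0 < t → t < n → q t ≠ u := by
    intro t h1 h2 h3
    rw [← hq0] at h3
    have := hinj _ _ (by omega) (by omega) h3
    omega
  have hadjG : ∀ a b, 0 < a → a < n → 0 < b → b < n → (G'.Adj (q a) (q b) ↔ G.Adj (q a) (q b)) := by
    intro a b h1 h2 h3 h4
    rw [hG']
    have := qne a h1 h2
    have := qne b h3 h4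
    tauto
  have hux : G'.Adj u (q 1) := by
    have := hadj 0 (by omega); rwa [hq0] at this
  have huy : G'.Adj u (q (n - 1)) := by
    have := hadj (n - 1) (by omega)
    rw [show n - 1 + 1 = n by omega, hc, hq0] at this
    exact this.symm
  have hG'u : ∀ z, G'.Adj u z → G.Adj u z ∨ OnH G u z := by
    intro z hz
    rcases (hG' u z).1 hz with h | ⟨h1, ⟨_, h⟩ | ⟨h2, _⟩⟩
    · exact Or.inl h
    · exact Or.inr h
    · exact absurd h2.symm h1
  have hxy : ¬ G.Adj (q 1) (q (n - 1)) := by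
    rw [← hadjG 1 (n - 1) (by omega) (by omega) (by omega) (by omega)]
    intro h
    have := hind 1 (n - 1) (by omega) (by omega) h
    omega
  have hxney : q 1 ≠ q (n - 1) := by
    intro h
    have := hinj _ _ (by omega) (by omega) h
    omega
  -- the set D
  obtain ⟨D, hDc, huD, hyD, huD', hxD, hxDa⟩ : ∃ D : Set V, (G.induce D).Preconnected ∧ u ∉ D ∧
      q (n - 1) ∈ D ∧ (∃ d ∈ D, G.Adj u d) ∧ q 1 ∉ D ∧ ∀ d ∈ D, ¬ G.Adj (q 1) d := by
    by_cases hy : G.Adj u (q (n - 1))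
    · refine ⟨{q (n - 1)}, ?_, ?_, rfl, ⟨_, rfl, hy⟩, by simpa using hxney, by simpa using hxy⟩
      · exact SimpleGraph.Preconnected.of_subsingleton
      · simpa using hy.ne
    · obtain ⟨m, r, l, hr, hr0, hl, hrl⟩ := (hG'u _ huy).resolve_left hy
      have hl0 : 0 < l := by
        rcases Nat.eq_zero_or_pos l with h | h
        · subst h; exact absurd (hrl.symm.trans hr0) (qne _ (by omega) (by omega))
        · exact h
      obtain ⟨r', hr', hr0', l', hl1, hl2, hl3, hl4⟩ := side (D := {q 1}) hnc hr hr0 hl0 hl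
        SimpleGraph.Preconnected.of_subsingleton
        (by simpa using (qne 1 (by omega) (by omega)).symm)
        (by rw [hrl]; simpa using hxney.symm)
        (by rw [hrl]; simpa using fun h => hxy h.symm)
      refine ⟨{z | ∃ i, 1 ≤ i ∧ i ≤ l' ∧ r' i = z},
        (arc_conn hl1 (fun i _ hi => hr'.2.2.2.1 i (by omega))).preconnected, ?_, ?_, ?_, ?_, ?_⟩
      · rintro ⟨i, h1, h2, h3⟩
        rw [← hr0'] at h3
        have := hr'.2.2.1 _ _ (by omega) (by omega) h3
        omega
      · exact ⟨l', hl1, le_refl _, hl3.trans hrl⟩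
      · refine ⟨r' 1, ⟨1, le_refl _, hl1, rfl⟩, ?_⟩
        have := hr'.2.2.2.1 0 (by omega)
        rwa [hr0'] at this
      · rintro ⟨i, h1, h2, h3⟩
        exact (hl4 i h1 h2).1 (by simp [h3])
      · rintro d ⟨i, h1, h2, rfl⟩ ha
        exact (hl4 i h1 h2).2 _ rfl ha.symm
  -- the arc of H
  obtain ⟨m, p, i, hp, hp0, him, hpi⟩ := (hG'u _ hux).resolve_left hnew
  have hi0 : 0 < i := by
    rcases Nat.eq_zero_or_pos i with h | h
    · subst h; exact absurd (hpi.symm.trans hp0) (qne _ (by omega) (by omega))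
    · exact h
  obtain ⟨p', hp', hp0', i', hi1, hi2, hi3, hi4⟩ := side hnc hp hp0 hi0 him hDc huD
    (by rwa [hpi]) (by rwa [hpi])
  rw [hpi] at hi3
  -- the set W
  have hWc : (G.induce {z | ∃ t, 2 ≤ t ∧ t ≤ n - 2 ∧ q t = z}).Connected := by
    apply arc_conn (by omega)
    intro t h1 h2
    rw [← hadjG t (t + 1) (by omega) (by omega) (by omega) (by omega)]
    exact hadj t (by omega)
  have hWu : ∀ w ∈ {z | ∃ t, 2 ≤ t ∧ t ≤ n - 2 ∧ q t = z}, w ≠ u ∧ ¬ G'.Adj u w := by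
    rintro w ⟨t, h1, h2, rfl⟩
    refine ⟨qne t (by omega) (by omega), ?_⟩
    intro h
    rw [← hq0] at h
    have := hind 0 t (by omega) (by omega) h
    omega
  have hxW : ∃ w ∈ {z | ∃ t, 2 ≤ t ∧ t ≤ n - 2 ∧ q t = z}, G.Adj (q 1) w := by
    refine ⟨q 2, ⟨2, le_refl _, by omega, rfl⟩, ?_⟩
    rw [← hadjG 1 2 (by omega) (by omega) (by omega) (by omega)]
    exact hadj 1 (by omega)
  have hWy : ∃ w ∈ {z | ∃ t, 2 ≤ t ∧ t ≤ n - 2 ∧ q t = z}, G.Adj w (q (n - 1)) := by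
    refine ⟨q (n - 2), ⟨n - 2, by omega, by omega, rfl⟩, ?_⟩
    rw [← hadjG (n - 2) (n - 1) (by omega) (by omega) (by omega) (by omega)]
    have := hadj (n - 2) (by omega)
    rwa [show n - 2 + 1 = n - 1 by omega] at this
  generalize {z | ∃ t, 2 ≤ t ∧ t ≤ n - 2 ∧ q t = z} = W at *
  have hOn : ∀ w ∈ W, ¬ OnH G u w := by
    intro w hw h
    exact (hWu w hw).2 ((hG' u w).2 (Or.inr ⟨(hWu w hw).1.symm, Or.inl ⟨rfl, h⟩⟩))
  have hAu : ∀ w ∈ W, ¬ G.Adj u w := by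
    intro w hw h
    exact (hWu w hw).2 ((hG' u w).2 (Or.inl h))
  have hpW : ∀ t, t < m → p' t ∉ W := by
    intro t ht h
    exact hOn _ h ⟨m, p', t, hp', hp0', ht, rfl⟩
  have hex : ∃ e, 0 < e ∧ e ≤ i' ∧ ∃ w ∈ W, G.Adj (p' e) w :=
    ⟨i', hi1, le_refl _, by rwa [hi3]⟩
  obtain ⟨he1, he2, he3⟩ := Nat.find_spec hex
  have hem := fun m (hm : m < Nat.find hex) => Nat.find_min hex hm
  generalize Nat.find hex = e at *
  obtain ⟨h4', hc', hinj', hadj', hind'⟩ := id hp'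
  obtain ⟨k, g, hg, hgv, hgk, hgD⟩ := hole_build (G := G) (s := e) (v := p') (D := W ∪ D) (by omega)
    (fun a b ha hb hab => hinj' a b (by omega) (by omega) hab)
    (fun a ha => hadj' a (by omega))
    (by
      intro a b hab hb ha
      rcases hind' a b hab (by omega) ha with h | ⟨h1, h2⟩
      · exact h
      · exfalso
        subst h1
        have hb' : b = i' := by omega
        subst hb'
        rw [hp0', hi3] at ha
        exact hnew ha)
    (by
      obtain ⟨w, hw, hwy⟩ := hWy
      exact (connected_induce_union hWc.preconnected hDc hw hyD hwy).preconnected)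
    (by
      rintro t ht (h | h)
      · exact hpW t (by omega) h
      · by_cases h1 : t = 0
        · subst h1; rw [hp0'] at h; exact huD h
        · exact (hi4 t (by omega) (by omega)).1 h)
    (by
      rintro t h1 h2 d (hd | hd) ha
      · exact hem t h2 ⟨h1, by omega, d, hd, ha⟩
      · exact (hi4 t (by omega) (by omega)).2 d hd ha)
    (by
      obtain ⟨d, hd, ha⟩ := huD'
      exact ⟨d, Or.inr hd, by rwa [hp0']⟩)
    (by
      obtain ⟨w, hw, ha⟩ := he3
      exact ⟨w, Or.inl hw, ha⟩)
    (by
      right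
      rintro d (hd | hd) ha hb
      · rw [hp0'] at ha; exact hAu d hd ha
      · exact (hi4 e (by omega) (by omega)).2 d hd hb)
  have hgm := hgD (e + 1) (by omega) (by omega)
  have hga := hg.2.2.2.1 e (by omega)
  rw [hgv e (le_refl _)] at hga
  rcases hgm with h | h
  · exact hOn _ h ⟨k, g, e + 1, hg, (hgv 0 (by omega)).trans hp0', hgk, rfl⟩
  · exact (hi4 e (by omega) (by omega)).2 _ h hga

lemma step {G G' : SimpleGraph V} {u : V} (hnc : NCs G u)
    (hG' : ∀ x y, G'.Adj x y ↔
      G.Adj x y ∨ (x ≠ y ∧ ((x = u ∧ OnH G u y) ∨ (y = u ∧ OnH G u x))))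
    {n : ℕ} {p : ℕ → V} (hp : HSeq G' n p) : HSeq G n p := by
  have aux : ∀ p, HSeq G' n p → ∀ i, i < n → p i = u → G.Adj (p i) (p (i + 1)) := by
    intro p hp i hi hpi
    by_contra hcon
    refine step_core hnc hG' (hp.rotate hi) (by simpa [hi] using hpi) ?_
    rw [← hpi]
    split_ifs with h
    · rwa [add_comm 1 i]
    · rw [show 1 + i - n = 0 by omega, ← hp.2.1, show n = i + 1 by omega]; exact hcon
  refine ⟨hp.1, hp.2.1, hp.2.2.1, ?_, ?_⟩
  · intro i hi
    rcases (hG' _ _).1 (hp.2.2.2.1 i hi) with h | ⟨_, ⟨h, _⟩ | ⟨h, _⟩⟩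
    · exact h
    · exact aux p hp i hi h
    · have := aux _ hp.reverse (n - (i + 1)) (by omega)
        (by rw [show n - (n - (i + 1)) = i + 1 by omega]; exact h)
      rw [show n - (n - (i + 1)) = i + 1 by omega,
        show n - (n - (i + 1) + 1) = i by omega] at this
      exact this.symm
  · intro i j hij hj ha
    exact hp.2.2.2.2 i j hij hj ((hG' _ _).2 (Or.inl ha))

lemma list_adj (l : List V) : ∀ (G : SimpleGraph V), (∀ u ∈ l, NCs G u) → ∀ x y,
    (chordalizeList G l).Adj x y →
      G.Adj x y ∨ (x ∈ l ∧ OnH G x y) ∨ (y ∈ l ∧ OnH G y x) := by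
  induction l with
  | nil => intro G _ x y h; exact Or.inl h
  | cons u l ih =>
    intro G hnc x y h
    have hs : ∀ n p, HSeq (localChordalize G u) n p → HSeq G n p := fun n p hp =>
      step (hnc u (by simp)) (fun x y => lc_adj) hp
    have hon : ∀ x y, OnH (localChordalize G u) x y → OnH G x y := by
      rintro x y ⟨n, p, i, hp, h⟩
      exact ⟨n, p, i, hs n p hp, h⟩
    have hnc' : ∀ v ∈ l, NCs (localChordalize G u) v := by
      intro v hv n p m q hp hq
      exact hnc v (by simp [hv]) n p m q (hs _ _ hp) (hs _ _ hq)
    rcases ih _ hnc' x y h with h | ⟨h1, h2⟩ | ⟨h1, h2⟩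
    · rcases lc_adj.1 h with h | ⟨_, ⟨rfl, h⟩ | ⟨rfl, h⟩⟩
      · exact Or.inl h
      · exact Or.inr (Or.inl ⟨by simp, h⟩)
      · exact Or.inr (Or.inr ⟨by simp, h⟩)
    · exact Or.inr (Or.inl ⟨by simp [h1], hon _ _ h2⟩)
    · exact Or.inr (Or.inr ⟨by simp [h1], hon _ _ h2⟩)

/-- No hole contains two vertices of `C` (sequence version). -/
def AMs (G : SimpleGraph V) (C : Set V) : Prop :=
  ∀ n p, HSeq G n p → ∀ i j, i < n → j < n → p i ∈ C → p j ∈ C → p i = p j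

lemma edge_hole {G : SimpleGraph V} {C : Set V} (am : AMs G C) {u₁ u₂ : V} (h₁ : u₁ ∈ C)
    (h₂ : u₂ ∈ C) (h : G.Adj u₁ u₂) {D : Set V} (hD : (G.induce D).Preconnected)
    (h1D : u₁ ∉ D) (h2D : u₂ ∉ D) (h1 : ∃ d ∈ D, G.Adj u₁ d) (h2 : ∃ d ∈ D, G.Adj u₂ d)
    (hn : ∀ d ∈ D, G.Adj u₁ d → ¬ G.Adj u₂ d) : False := by
  obtain ⟨n, q, hq, hqv, hqn, -⟩ := hole_build (G := G) (s := 1)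
    (v := fun t => if t = 0 then u₁ else u₂) (D := D) (le_refl _)
    (by
      intro i j hi hj hij
      have := h.ne
      have := h.ne.symm
      split_ifs at hij <;> first | omega | contradiction)
    (by
      intro i hi
      have : i = 0 := by omega
      subst this
      simpa using h)
    (by intro i j hi hj _; omega)
    hD
    (by intro i _; split_ifs <;> assumption)
    (by intro i h1 h2; omega)
    (by simpa using h1) (by simpa using h2) (by right; simpa using hn)
  have e0 := hqv 0 (by omega)
  have e1 := hqv 1 (by omega)
  simp only [if_true, one_ne_zero, if_false] at e0 e1
  have := am n q hq 0 1 (by omega) (by omega) (by rwa [e0]) (by rwa [e1])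
  rw [e0, e1] at this
  exact h.ne this

lemma side_arc {G : SimpleGraph V} {u u' m : V} (hnc : NCs G u) (ho : OnH G u m) (hmu : m ≠ u)
    (hmu' : m ≠ u') (huu' : u ≠ u') (ha : ¬ G.Adj u' m) :
    ∃ D : Set V, (G.induce D).Preconnected ∧ m ∈ D ∧ u ∉ D ∧ u' ∉ D ∧ (∃ d ∈ D, G.Adj u d) ∧
      ∀ d ∈ D, ¬ G.Adj u' d := by
  obtain ⟨k, r, l, hr, hr0, hl, hrl⟩ := ho
  have hl0 : 0 < l := by
    rcases Nat.eq_zero_or_pos l with h | h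
    · subst h; exact absurd (hrl.symm.trans hr0) hmu
    · exact h
  obtain ⟨r', hr', hr0', l', hl1, hl2, hl3, hl4⟩ := side (D := {u'}) hnc hr hr0 hl0 hl
    SimpleGraph.Preconnected.of_subsingleton
    (by simpa using huu')
    (by rw [hrl]; simpa using hmu')
    (by rw [hrl]; simpa using fun h => ha h.symm)
  refine ⟨{z | ∃ i, 1 ≤ i ∧ i ≤ l' ∧ r' i = z},
    (arc_conn hl1 (fun i _ hi => hr'.2.2.2.1 i (by omega))).preconnected, ?_, ?_, ?_, ?_, ?_⟩
  · exact ⟨l', hl1, le_refl _, hl3.trans hrl⟩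
  · rintro ⟨i, h1, h2, h3⟩
    rw [← hr0'] at h3
    have := hr'.2.2.1 _ _ (by omega) (by omega) h3
    omega
  · rintro ⟨i, h1, h2, h3⟩
    exact (hl4 i h1 h2).1 (by simp [h3])
  · refine ⟨r' 1, ⟨1, le_refl _, hl1, rfl⟩, ?_⟩
    have := hr'.2.2.2.1 0 (by omega)
    rwa [hr0'] at this
  · rintro d ⟨i, h1, h2, rfl⟩ ha
    exact (hl4 i h1 h2).2 _ rfl ha.symm

lemma no_common {G : SimpleGraph V} {C : Set V} (am : AMs G C) (hnc : ∀ u ∈ C, NCs G u)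
    {u₁ u₂ m : V} (h₁ : u₁ ∈ C) (h₂ : u₂ ∈ C) (h : G.Adj u₁ u₂) (hm1 : m ≠ u₁) (hm2 : m ≠ u₂)
    (o1 : OnH G u₁ m) (o2 : OnH G u₂ m) (a1 : ¬ G.Adj u₁ m) (a2 : ¬ G.Adj u₂ m) : False := by
  obtain ⟨D, d1, d2, d3, d4, d5, d6⟩ := side_arc (hnc _ h₁) o1 hm1 hm2 h.ne a2
  obtain ⟨E, e1, e2, e3, e4, e5, e6⟩ := side_arc (hnc _ h₂) o2 hm2 hm1 h.ne.symm a1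
  refine edge_hole am h₁ h₂ h (D := D ∪ E)
    (induce_union_connected d1 e1 ⟨m, d2, e2⟩).preconnected ?_ ?_ ?_ ?_ ?_
  · rintro (h | h) <;> contradiction
  · rintro (h | h) <;> contradiction
  · obtain ⟨d, hd, h⟩ := d5; exact ⟨d, Or.inl hd, h⟩
  · obtain ⟨d, hd, h⟩ := e5; exact ⟨d, Or.inr hd, h⟩
  · rintro d (hd | hd) x y
    · exact d6 d hd y
    · exact e6 d hd x

lemma minor_of {G : SimpleGraph V} {K : Finset V} {u : V} {S : Set V}
    (huS : u ∈ S) (hSK : ∀ x ∈ S, x ∈ K → x = u) (hS : (G.induce S).Connected)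
    (hK : ∀ a ∈ K, ∀ b ∈ K, a ≠ b → a ≠ u → b ≠ u → G.Adj a b)
    (hu : ∀ m ∈ K, m ≠ u → ∃ s ∈ S, G.Adj s m) :
    HasMinor G (⊤ : SimpleGraph (Fin K.card)) := by
  classical
  let f : Fin K.card → V := fun i => (K.equivFin.symm i : V)
  have hf : ∀ i, f i ∈ K := fun i => (K.equivFin.symm i).2
  have hfi : ∀ i j, f i = f j → i = j := by
    intro i j h
    exact K.equivFin.symm.injective (Subtype.ext h)
  refine ⟨fun i => if f i = u then S else {f i}, ?_, ?_, ?_, ?_⟩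
  · intro i
    simp only
    split_ifs
    · exact ⟨u, huS⟩
    · exact ⟨_, rfl⟩
  · intro i
    show (G.induce (if f i = u then S else {f i})).Connected
    by_cases h1 : f i = u
    · rw [if_pos h1]; exact hS
    · rw [if_neg h1]
      exact @SimpleGraph.Connected.mk _ _ SimpleGraph.Preconnected.of_subsingleton ⟨_, rfl⟩
  · intro i j hij
    have hne : f i ≠ f j := fun h => hij (hfi i j h)
    simp only
    split_ifs with h1 h2 h2
    · exact absurd (h1.trans h2.symm) hne
    · rw [Set.disjoint_singleton_right]
      exact fun h => h2 (hSK _ h (hf j))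
    · rw [Set.disjoint_singleton_left]
      exact fun h => h1 (hSK _ h (hf i))
    · rw [Set.disjoint_singleton]; exact hne
  · intro i j hij
    have hne : f i ≠ f j := fun h => (SimpleGraph.top_adj i j).1 hij (hfi i j h)
    simp only
    split_ifs with h1 h2 h2
    · exact absurd (h1.trans h2.symm) hne
    · obtain ⟨s, hs, h⟩ := hu _ (hf j) h2
      exact ⟨s, hs, _, rfl, h⟩
    · obtain ⟨s, hs, h⟩ := hu _ (hf i) h1
      exact ⟨_, rfl, s, hs, h.symm⟩
    · exact ⟨_, rfl, _, rfl, hK _ (hf i) _ (hf j) hne h1 h2⟩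

/-- every clique of `Ĝ(C)` yields a complete minor of `G` of the same size. -/
theorem stmt9 {V : Type*} [Fintype V] [DecidableEq V] (G : SimpleGraph V) (C : Set V)
    (hcov : IsHoleCover G C) (hNC : SetNC G C)
    (l : List V) (hl : l.Nodup) (hlC : {v | v ∈ l} = C)
    (K : Finset V) (hK : (chordalizeList G l).IsClique ↑K) :
    HasMinor G (⊤ : SimpleGraph (Fin K.card)) := by
  have hmem : ∀ x, x ∈ l ↔ x ∈ C := by intro x; rw [← hlC]; rfl
  have hnc : ∀ u ∈ C, NCs G u := fun u hu => nc_of_vertexNC (hNC.1 u hu)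
  have am : AMs G C := by
    intro n p hp i j hi hj h1 h2
    obtain ⟨w, hw, hws, _⟩ := walk_of_hseq hp
    exact hNC.2 _ w hw _ h1 _ h2 ((hws _).2 ⟨i, hi, rfl⟩) ((hws _).2 ⟨j, hj, rfl⟩)
  have honC : ∀ u m, u ∈ C → OnH G u m → m ≠ u → m ∉ C := by
    rintro u m hu ⟨n, p, i, hp, h0, hi, rfl⟩ hne hm
    exact hne ((am n p hp i 0 hi (by omega) hm (by rwa [h0])).trans h0)
  have hpair : ∀ a ∈ K, ∀ b ∈ K, a ≠ b →
      G.Adj a b ∨ (a ∈ C ∧ OnH G a b) ∨ (b ∈ C ∧ OnH G b a) := by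
    intro a ha b hb hab
    have := list_adj l G (fun u hu => hnc u ((hmem u).1 hu)) a b (hK ha hb hab)
    simpa only [hmem] using this
  have hNN : ∀ a ∈ K, ∀ b ∈ K, a ≠ b → a ∉ C → b ∉ C → G.Adj a b := by
    intro a ha b hb hab h1 h2
    rcases hpair a ha b hb hab with h | h | h
    · exact h
    · exact absurd h.1 h1
    · exact absurd h.1 h2
  have hCC : ∀ a ∈ K, ∀ b ∈ K, a ≠ b → a ∈ C → b ∈ C → G.Adj a b := by
    intro a ha b hb hab h1 h2
    rcases hpair a ha b hb hab with h | h | h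
    · exact h
    · exact absurd h2 (honC _ _ h1 h.2 hab.symm)
    · exact absurd h1 (honC _ _ h2 h.2 hab)
  have hbad : ∀ u ∈ K, ∀ m ∈ K, m ≠ u → u ∈ C → ¬ G.Adj u m → m ∉ C ∧ OnH G u m := by
    intro u hu m hm hne huC ha
    have hmC : m ∉ C := fun h => ha (hCC u hu m hm hne.symm huC h)
    rcases hpair u hu m hm hne.symm with h | h | h
    · exact absurd h ha
    · exact ⟨hmC, h.2⟩
    · exact absurd h.1 hmC
  have huniq : ∀ u₁ ∈ K, ∀ u₂ ∈ K, ∀ m₁ ∈ K, ∀ m₂ ∈ K, u₁ ∈ C → u₂ ∈ C → m₁ ≠ u₁ → m₂ ≠ u₂ →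
      ¬ G.Adj u₁ m₁ → ¬ G.Adj u₂ m₂ → u₁ = u₂ := by
    intro u₁ hu₁ u₂ hu₂ m₁ hm₁ m₂ hm₂ c₁ c₂ n₁ n₂ a₁ a₂
    by_contra hne
    have hadj := hCC u₁ hu₁ u₂ hu₂ hne c₁ c₂
    obtain ⟨b₁, o₁⟩ := hbad u₁ hu₁ m₁ hm₁ n₁ c₁ a₁
    obtain ⟨b₂, o₂⟩ := hbad u₂ hu₂ m₂ hm₂ n₂ c₂ a₂
    have n₁₂ : m₁ ≠ u₂ := fun h => b₁ (h ▸ c₂)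
    have n₂₁ : m₂ ≠ u₁ := fun h => b₂ (h ▸ c₁)
    by_cases x : G.Adj u₂ m₁
    · by_cases y : G.Adj u₁ m₂
      · have hmm : m₁ ≠ m₂ := fun h => a₁ (h ▸ y)
        have := hNN m₁ hm₁ m₂ hm₂ hmm b₁ b₂
        refine edge_hole am c₁ c₂ hadj (D := {m₁, m₂})
          (induce_pair_connected_of_adj this).preconnected ?_ ?_ ⟨m₂, by simp, y⟩
          ⟨m₁, by simp, x⟩ ?_
        · simp [n₁.symm, n₂₁.symm]
        · simp [n₂.symm, n₁₂.symm]
        · rintro d (rfl | rfl) h1 h2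
          · exact a₁ h1
          · exact a₂ h2
      · exact no_common am hnc c₁ c₂ hadj n₂₁ n₂ (hbad u₁ hu₁ m₂ hm₂ n₂₁ c₁ y).2 o₂ y a₂
    · exact no_common am hnc c₁ c₂ hadj n₁ n₁₂ o₁ (hbad u₂ hu₂ m₁ hm₁ n₁₂ c₂ x).2 a₁ x
  by_cases hB : ∃ u ∈ K, u ∈ C ∧ ∃ m ∈ K, m ≠ u ∧ ¬ G.Adj u m
  · obtain ⟨u, huK, huC, m₀, hm₀, hn₀, ha₀⟩ := hB
    -- arcs
    have harc : ∀ m ∈ K, m ≠ u → ∃ A : Set V, u ∈ A ∧ (G.induce A).Connected ∧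
        (∀ x ∈ A, x ∈ K → x = u) ∧ ∃ s ∈ A, G.Adj s m := by
      intro m hm hne
      by_cases ha : G.Adj u m
      · refine ⟨{u}, rfl, ?_, fun x hx _ => hx, u, rfl, ha⟩
        exact @SimpleGraph.Connected.mk _ _ SimpleGraph.Preconnected.of_subsingleton ⟨_, rfl⟩
      · obtain ⟨hmC, n, p, i, hp, h0, hi, hpi⟩ := hbad u huK m hm hne huC ha
        have hi0 : 0 < i := by
          rcases Nat.eq_zero_or_pos i with h | h
          · subst h; exact absurd (hpi.symm.trans h0) hne
          · exact h
        have aux : ∀ p i, HSeq G n p → p 0 = u → i < n → 0 < i → p i = m →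
            (∀ s, 0 < s → s < i → p s ∉ K) → ∃ A : Set V, u ∈ A ∧ (G.induce A).Connected ∧
            (∀ x ∈ A, x ∈ K → x = u) ∧ ∃ s ∈ A, G.Adj s m := by
          intro p i hp h0 hi hi0 hpi hs
          refine ⟨{z | ∃ t, 0 ≤ t ∧ t ≤ i - 1 ∧ p t = z}, ⟨0, le_refl _, by omega, h0⟩,
            arc_conn (by omega) (fun t _ ht => hp.2.2.2.1 t (by omega)), ?_, ?_⟩
          · rintro x ⟨t, _, ht, rfl⟩ hx
            rcases Nat.eq_zero_or_pos t with h | h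
            · rw [h, h0]
            · exact absurd hx (hs t h (by omega))
          · refine ⟨p (i - 1), ⟨i - 1, by omega, le_refl _, rfl⟩, ?_⟩
            have := hp.2.2.2.1 (i - 1) (by omega)
            rwa [show i - 1 + 1 = i by omega, hpi] at this
        by_cases h1 : ∀ s, 0 < s → s < i → p s ∉ K
        · exact aux p i hp h0 hi hi0 hpi h1
        · by_cases h2 : ∀ s, 0 < s → s < n - i → p (n - s) ∉ K
          · exact aux _ (n - i) hp.reverse (by simp [hp.2.1, h0]) (by omega) (by omega)
              (by rw [show n - (n - i) = i by omega, hpi]) h2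
          · exfalso
            push Not at h1 h2
            obtain ⟨s, s1, s2, s3⟩ := h1
            obtain ⟨t, t1, t2, t3⟩ := h2
            have hC : ∀ k, 0 < k → k < n → p k ∉ C := by
              intro k k1 k2 hk
              have := am n p hp k 0 k2 (by omega) hk (by rwa [h0])
              have := hp.2.2.1 _ _ k2 (by omega) this
              omega
            have hA : ∀ a b, a < b → 0 < a → b < n → p a ∈ K → p b ∈ K → b = a + 1 := by
              intro a b hab ha hb x y
              have : p a ≠ p b := by
                intro h
                have := hp.2.2.1 _ _ (by omega) (by omega) h
                omega
              have := hNN _ x _ y this (hC a ha (by omega)) (hC b (by omega) hb)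
              have := hp.2.2.2.2 a b hab hb this
              omega
            have := hA s i s2 s1 hi s3 (by rwa [hpi])
            have := hA s (n - t) (by omega) s1 (by omega) s3 t3
            omega
    choose! A hA1 hA2 hA3 hA4 using harc
    refine minor_of (u := u) (S := ⋃₀ {T | ∃ m, m ∈ K ∧ m ≠ u ∧ T = A m}) ?_ ?_ ?_ ?_ ?_
    · exact ⟨A m₀, ⟨m₀, hm₀, hn₀, rfl⟩, hA1 m₀ hm₀ hn₀⟩
    · rintro x ⟨_, ⟨m, hm, hn, rfl⟩, hx⟩ hxK
      exact hA3 m hm hn x hx hxK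
    · apply induce_sUnion_connected_of_pairwise_not_disjoint
      · exact ⟨_, m₀, hm₀, hn₀, rfl⟩
      · rintro _ _ ⟨m, hm, hn, rfl⟩ ⟨m', hm', hn', rfl⟩
        exact ⟨u, hA1 m hm hn, hA1 m' hm' hn'⟩
      · rintro _ ⟨m, hm, hn, rfl⟩
        exact hA2 m hm hn
    · intro a ha b hb hab hau hbu
      by_contra hcon
      by_cases ca : a ∈ C
      · exact hau (huniq a ha u huK b hb m₀ hm₀ ca huC hab.symm hn₀ hcon ha₀)
      · by_cases cb : b ∈ C
        · exact hbu (huniq b hb u huK a ha m₀ hm₀ cb huC hab hn₀ (fun h => hcon h.symm) ha₀)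
        · exact hcon (hNN a ha b hb hab ca cb)
    · intro m hm hn
      obtain ⟨s, hs, h⟩ := hA4 m hm hn
      exact ⟨s, ⟨A m, ⟨m, hm, hn, rfl⟩, hs⟩, h⟩
  · push Not at hB
    have hall : ∀ a ∈ K, ∀ b ∈ K, a ≠ b → G.Adj a b := by
      intro a ha b hb hab
      by_cases ca : a ∈ C
      · exact hB a ha ca b hb hab.symm
      · by_cases cb : b ∈ C
        · exact (hB b hb cb a ha hab).symm
        · exact hNN a ha b hb hab ca cb
    rcases K.eq_empty_or_nonempty with rfl | ⟨u, hu⟩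
    · refine ⟨fun _ => ∅, ?_, ?_, ?_, ?_⟩
      · intro i; exact absurd i.2 (by simp)
      · intro i; exact absurd i.2 (by simp)
      · intro i; exact absurd i.2 (by simp)
      · intro i; exact absurd i.2 (by simp)
    · refine minor_of (u := u) (S := {u}) rfl (fun x hx _ => hx) ?_ ?_ ?_
      · exact @SimpleGraph.Connected.mk _ _ SimpleGraph.Preconnected.of_subsingleton ⟨_, rfl⟩
      · intro a ha b hb hab _ _; exact hall a ha b hb hab
      · intro m hm hn; exact ⟨u, rfl, hall u hu m hm hn.symm⟩
end
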